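/- arXiv:2003.03639 — 3 statements merged into one kernel-verified Lean document; each statement's English description precedes it below -/
import Mathlib

section
/- Let G be a cycle digraph with n ≥ 2 vertices. If n is odd, then G has no skew-symmetry. If n is even, then G has exactly n/2 skew-symmetries, and every skew-symmetry σ of G has a unit, i.e., there exists a vertex v with (v, σ(v)) ∈ E(G). -/
/-- A literal: a variable (a natural number) together with a polarity. -/
abbrev Lit : Type := ℕ × Bool

/-- Complementation of literals: a fixed-point-free involution. -/
def Lit.compl (x : Lit) : Lit := (x.1, !x.2)

/-- The set of variables occurring in a clause-set. -/
def varsOf (F : Finset (Finset Lit)) : Finset ℕ := F.biUnion (fun C => C.image Prod.fst)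

/-- The literals over the variables of `F` (both polarities). -/
def litsOf (F : Finset (Finset Lit)) : Finset Lit := varsOf F ×ˢ (Finset.univ : Finset Bool)

/-- A clause is clash-free. -/
def IsClause (C : Finset Lit) : Prop := ∀ x ∈ C, Lit.compl x ∉ C

/-- A clause-set consists of clauses. -/
def IsClauseSet (F : Finset (Finset Lit)) : Prop := ∀ C ∈ F, IsClause C

/-- The truth value of a literal under a total assignment. -/
def LitVal (φ : ℕ → Bool) (x : Lit) : Bool := if x.2 then φ x.1 else !(φ x.1)

/-- Satisfiability of a clause-set. -/
def Sat (F : Finset (Finset Lit)) : Prop := ∃ φ : ℕ → Bool, ∀ C ∈ F, ∃ x ∈ C, LitVal φ x = true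

/-- Minimal unsatisfiability. -/
def MU (F : Finset (Finset Lit)) : Prop := IsClauseSet F ∧ ¬ Sat F ∧ ∀ G ⊂ F, Sat G

/-- Minimally unsatisfiable 2-clause-set. -/
def MU2 (F : Finset (Finset Lit)) : Prop := MU F ∧ ∀ C ∈ F, C.card ≤ 2

/-- The deficiency δ(F) = c(F) - n(F). -/
def deficiency (F : Finset (Finset Lit)) : ℤ := (F.card : ℤ) - ((varsOf F).card : ℤ)

/-- Literal-degree: number of clauses containing the literal. -/
def ldeg (F : Finset (Finset Lit)) (x : Lit) : ℕ := (F.filter (fun C => x ∈ C)).card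

/-- Variable-degree. -/
def vdeg (F : Finset (Finset Lit)) (v : ℕ) : ℕ := ldeg F (v, true) + ldeg F (v, false)

/-- Isomorphism of clause-sets: a bijection between the literals over the variables,
commuting with complementation, mapping one clause-set onto the other. -/
def CNFIso (F F' : Finset (Finset Lit)) (f : Lit → Lit) : Prop :=
  Set.BijOn f ↑(litsOf F) ↑(litsOf F') ∧
  (∀ x ∈ litsOf F, f (Lit.compl x) = Lit.compl (f x)) ∧
  F.image (fun C => C.image f) = F'

/-- A digraph: a finite vertex set and a finite set of arcs. -/
structure FinDigraph (α : Type) where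
  V : Finset α
  E : Finset (α × α)

/-- Well-formedness of a digraph: arcs join distinct vertices. -/
def FinDigraph.WellFormed {α : Type} (G : FinDigraph α) : Prop :=
  ∀ p ∈ G.E, p.1 ∈ G.V ∧ p.2 ∈ G.V ∧ p.1 ≠ p.2

/-- `f` is an isomorphism of digraphs from `G` to `G'`. -/
def DigraphIso {α β : Type} [DecidableEq β] (G : FinDigraph α) (G' : FinDigraph β) (f : α → β) : Prop :=
  Set.BijOn f ↑G.V ↑G'.V ∧ G.E.image (fun p => (f p.1, f p.2)) = G'.E

/-- The implication digraph of a 2-clause-set (without the empty clause):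
vertices are the literals over the variables of `F`, and there is an arc `(a,b)` iff
`{compl a} ∪ {b}` is a clause of `F` (this yields `(x̄,y),(ȳ,x)` for a clause `{x,y}`
and `(x̄,x)` for a unit-clause `{x}`). -/
def idg (F : Finset (Finset Lit)) : FinDigraph Lit :=
  ⟨litsOf F, (litsOf F ×ˢ litsOf F).filter (fun p => insert (Lit.compl p.1) {p.2} ∈ F)⟩

def FinDigraph.inDeg {α : Type} [DecidableEq α] (G : FinDigraph α) (v : α) : ℕ :=
  (G.E.filter (fun p => p.2 = v)).card

def FinDigraph.outDeg {α : Type} [DecidableEq α] (G : FinDigraph α) (v : α) : ℕ :=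
  (G.E.filter (fun p => p.1 = v)).card

/-- The standard double `m`-cycle. -/
def stdDoubleCycle (m : ℕ) : FinDigraph ℕ :=
  ⟨Finset.range m, (Finset.range m).biUnion (fun i => {(i, (i+1) % m), ((i+1) % m, i)})⟩

/-- A double `m`-cycle (`m ≥ 3`). -/
def IsDoubleCycle {α : Type} [DecidableEq α] (m : ℕ) (G : FinDigraph α) : Prop :=
  3 ≤ m ∧ ∃ f : ℕ → α, DigraphIso (stdDoubleCycle m) G f

/-- Splitting a vertex `x` into `u`, `v` with a new arc `(u,v)`:
arcs into `x` now go into `u`, arcs out of `x` now leave `v`. -/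
def SplitVertex {α : Type} [DecidableEq α] (G G' : FinDigraph α) : Prop :=
  ∃ x u v, x ∈ G.V ∧ u ∉ G.V ∧ v ∉ G.V ∧ u ≠ v ∧
    G'.V = insert u (insert v (G.V.erase x)) ∧
    G'.E = insert (u, v)
      ((G.E.filter (fun p => p.1 ≠ x ∧ p.2 ≠ x)) ∪
       ((G.E.filter (fun p => p.2 = x)).image (fun p => (p.1, u))) ∪
       ((G.E.filter (fun p => p.1 = x)).image (fun p => (v, p.2))))

/-- Splitting an arc `(x,y)` by a new (linear) vertex `v`. -/
def SplitArc {α : Type} [DecidableEq α] (G G' : FinDigraph α) : Prop :=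
  ∃ x y v, (x, y) ∈ G.E ∧ v ∉ G.V ∧
    G'.V = insert v G.V ∧
    G'.E = insert (x, v) (insert (v, y) (G.E.erase (x, y)))

/-- An `m`-weak-double-cycle: obtained from a double `m`-cycle by a finite sequence
of vertex splittings and arc splittings. -/
def IsWDC {α : Type} [DecidableEq α] (m : ℕ) (G : FinDigraph α) : Prop :=
  ∃ G₀ : FinDigraph α, IsDoubleCycle m G₀ ∧
    Relation.ReflTransGen (fun A B => SplitVertex A B ∨ SplitArc A B) G₀ G

/-- A digraph is nonlinear if no vertex has in-degree 1 and out-degree 1. -/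
def FinDigraph.Nonlinear {α : Type} [DecidableEq α] (G : FinDigraph α) : Prop :=
  ∀ v ∈ G.V, ¬ (G.inDeg v = 1 ∧ G.outDeg v = 1)

/-- Strong connectivity. -/
def StronglyConnected {α : Type} (G : FinDigraph α) : Prop :=
  ∀ a ∈ G.V, ∀ b ∈ G.V, Relation.ReflTransGen (fun x y => (x, y) ∈ G.E) a b

/-- A cycle digraph: strongly connected, at least 2 vertices, all vertices linear. -/
def IsCycleDigraph {α : Type} [DecidableEq α] (G : FinDigraph α) : Prop :=
  G.WellFormed ∧ 2 ≤ G.V.card ∧ StronglyConnected G ∧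
    ∀ v ∈ G.V, G.inDeg v = 1 ∧ G.outDeg v = 1

/-- A skew-symmetry of a digraph, as a permutation of its vertex set:
a fixed-point-free involution reversing arcs. -/
def IsSkewSym {α : Type} (G : FinDigraph α) (σ : Equiv.Perm {x // x ∈ G.V}) : Prop :=
  (∀ v, σ (σ v) = v) ∧ (∀ v, σ v ≠ v) ∧
  ∀ a b : {x // x ∈ G.V}, ((a : α), (b : α)) ∈ G.E → (((σ b : α)), ((σ a : α))) ∈ G.E

/-- A skew-symmetry has a unit if some vertex is joined by an arc to its image. -/
def HasUnit {α : Type} (G : FinDigraph α) (σ : Equiv.Perm {x // x ∈ G.V}) : Prop :=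
  ∃ v : {x // x ∈ G.V}, ((v : α), ((σ v : α))) ∈ G.E

/-- The literals over the variables of `F` are closed under complementation. -/
lemma compl_mem {F : Finset (Finset Lit)} {x : Lit} (h : x ∈ litsOf F) :
    Lit.compl x ∈ litsOf F := by
  simp only [litsOf, Lit.compl, Finset.mem_product] at h ⊢
  exact ⟨h.1, Finset.mem_univ _⟩

/-- Clause-set isomorphism, as an equivalence between the literals over the variables. -/
def CNFIsoE (F F' : Finset (Finset Lit))
    (e : {x // x ∈ litsOf F} ≃ {x // x ∈ litsOf F'}) : Prop :=
  (∀ x : {x // x ∈ litsOf F}, (e ⟨Lit.compl x.1, compl_mem x.2⟩ : Lit) = Lit.compl (e x : Lit)) ∧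
  F.image (fun C => C.image (fun y =>
      if h : y ∈ litsOf F then ((e ⟨y, h⟩ : {x // x ∈ litsOf F'}) : Lit) else y)) = F'

/-- An automorphism of a digraph, as a permutation of its vertex set preserving arcs. -/
def FinDigraphAut {α : Type} (G : FinDigraph α) (π : Equiv.Perm {x // x ∈ G.V}) : Prop :=
  ∀ a b : {x // x ∈ G.V}, ((a : α), (b : α)) ∈ G.E ↔ ((π a : α), (π b : α)) ∈ G.E

/-- Multiplicity of the edge between `u` and `v` in the underlying multigraph of a digraph. -/
def mult {α : Type} [DecidableEq α] (G : FinDigraph α) (u v : α) : ℕ :=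
  (if (u, v) ∈ G.E then 1 else 0) + (if (v, u) ∈ G.E then 1 else 0)

/-- `f` is an isomorphism between the underlying multigraphs of two digraphs. -/
def MultigraphIso {α β : Type} [DecidableEq α] [DecidableEq β]
    (G : FinDigraph α) (G' : FinDigraph β) (f : α → β) : Prop :=
  Set.BijOn f ↑G.V ↑G'.V ∧ ∀ u ∈ G.V, ∀ v ∈ G.V, mult G u v = mult G' (f u) (f v)

/-- `f` is an isomorphism between the underlying graphs of two digraphs. -/
def GraphIso {α β : Type} (G : FinDigraph α) (G' : FinDigraph β) (f : α → β) : Prop :=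
  Set.BijOn f ↑G.V ↑G'.V ∧ ∀ u ∈ G.V, ∀ v ∈ G.V,
    (((u, v) ∈ G.E ∨ (v, u) ∈ G.E) ↔ ((f u, f v) ∈ G'.E ∨ (f v, f u) ∈ G'.E))

/-- The transpose of a digraph: all arcs reversed. -/
def FinDigraph.transpose {α : Type} [DecidableEq α] (G : FinDigraph α) : FinDigraph α :=
  ⟨G.V, G.E.image (fun p => (p.2, p.1))⟩

/-- DP-reduction on variable `v`: replace all clauses containing `v` or `v̄` by all
their non-tautological resolvents on `v`. -/
def DP (v : ℕ) (F : Finset (Finset Lit)) : Finset (Finset Lit) :=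
  (F.filter (fun C => (v, true) ∉ C ∧ (v, false) ∉ C)) ∪
  ((((F.filter (fun C => (v, true) ∈ C)) ×ˢ (F.filter (fun C => (v, false) ∈ C))).image
      (fun p => (p.1.erase (v, true)) ∪ (p.2.erase (v, false)))).filter
    (fun C => ∀ x ∈ C, Lit.compl x ∉ C))

/-- A variable is singular if one of its literals has literal-degree 1. -/
def Singular (F : Finset (Finset Lit)) (v : ℕ) : Prop :=
  ldeg F (v, true) = 1 ∨ ldeg F (v, false) = 1

/-- The "middle part" `M_n = {{v̄_1,v_2},…,{v̄_{n−1},v_n}}`, with variables `1,…,n`. -/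
def Mn (n : ℕ) : Finset (Finset Lit) :=
  (Finset.Icc 1 (n - 1)).image (fun i => ({(i, false), (i + 1, true)} : Finset Lit))

def famU2 (n : ℕ) : Finset (Finset Lit) :=
  Mn n ∪ {({((1 : ℕ), true)} : Finset Lit), ({((n : ℕ), false)} : Finset Lit)}

def famU1 (n i : ℕ) : Finset (Finset Lit) :=
  Mn n ∪ {({((1 : ℕ), true)} : Finset Lit), ({((n : ℕ), false), ((i : ℕ), false)} : Finset Lit)}

def famU0s (n i : ℕ) : Finset (Finset Lit) :=
  Mn n ∪ {({((1 : ℕ), true), ((i : ℕ), true)} : Finset Lit),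
          ({((n : ℕ), false), ((i : ℕ), false)} : Finset Lit)}

def famU0 (n x y : ℕ) : Finset (Finset Lit) :=
  Mn n ∪ {({((1 : ℕ), true), ((x : ℕ), true)} : Finset Lit),
          ({((n : ℕ), false), ((y : ℕ), false)} : Finset Lit)}

/-- Membership in one of the four families (with the stated parameter ranges). -/
def InFam (G : Finset (Finset Lit)) : Prop :=
  (∃ n, 1 ≤ n ∧ G = famU2 n) ∨
  (∃ n i, 2 ≤ n ∧ 1 ≤ i ∧ i ≤ n - 1 ∧ G = famU1 n i) ∨
  (∃ n i, 3 ≤ n ∧ 2 ≤ i ∧ 2 * i ≤ n + 1 ∧ G = famU0s n i) ∨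
  (∃ n x y, 4 ≤ n ∧ 2 ≤ x ∧ x < y ∧ y ≤ n - 1 ∧ x + y ≤ n + 1 ∧ G = famU0 n x y)

/-- The number of unit-clauses of `F`. -/
def unitCount (F : Finset (Finset Lit)) : ℕ := (F.filter (fun C => C.card = 1)).card

/-- MU 2-clause-sets of deficiency `k` with exactly `n` variables. -/
def MU2dn (k : ℤ) (n : ℕ) : Type :=
  {F : Finset (Finset Lit) // MU2 F ∧ deficiency F = k ∧ (varsOf F).card = n}

/-- Isomorphism relation on `MU2dn k n`. -/
def isoRel {k : ℤ} {n : ℕ} (F F' : MU2dn k n) : Prop := ∃ f, CNFIso F.1 F'.1 f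

/-- The number of isomorphism classes of MU 2-clause-sets of deficiency `k`
with exactly `n` variables. -/
noncomputable def numClasses (k : ℤ) (n : ℕ) : ℕ := Nat.card (Quot (@isoRel k n))

/-- Equivalence of binary bracelets of length `m`: rotations and reflections of the
cyclic index set. -/
def BraceletRel (m : ℕ) (b b' : ZMod m → Bool) : Prop :=
  ∃ (r : ZMod m) (s : Bool), ∀ i, b' i = b (if s then r - i else i + r)

/-- Digraph-isomorphism relation on nonlinear `m`-WDCs. -/
def NonlinWDCRel (m : ℕ) (G G' : {G : FinDigraph ℕ // IsWDC m G ∧ G.Nonlinear}) : Prop :=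
  ∃ f : ℕ → ℕ, DigraphIso G.1 G'.1 f

/-- `H` is a subdigraph of `G`. -/
def Subdigraph {α : Type} (H G : FinDigraph α) : Prop := H.V ⊆ G.V ∧ H.E ⊆ G.E

namespace ZMod

lemma even_or_odd {n : ℕ} [NeZero n] (c : ZMod n) : Even c ∨ Even (c - 1) := by
  rw [← natCast_zmod_val c]
  rcases Nat.even_or_odd' c.val with ⟨k, hk | hk⟩
  · exact Or.inl ⟨k, by rw [hk]; push_cast; ring⟩
  · exact Or.inr ⟨k, by rw [hk]; push_cast; ring⟩

lemma even_of_odd {n : ℕ} (hn : Odd n) (c : ZMod n) : Even c := by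
  obtain ⟨j, hj⟩ := hn
  have h : ((2 * j + 1 : ℕ) : ZMod n) = 0 := by rw [← hj, natCast_self]
  push_cast at h
  exact ⟨(j + 1) * c, by linear_combination -c * h⟩

lemma even_add_one_iff {n : ℕ} [NeZero n] (hn : Even n) (c : ZMod n) :
    Even (c + 1) ↔ ¬ Even c := by
  constructor
  · rintro ⟨x, hx⟩ ⟨y, hy⟩
    have h := congrArg (castHom hn.two_dvd (ZMod 2)) (show (1 : ZMod n) = 2 * (x - y) by
      linear_combination hx - hy)
    rw [map_one, map_mul, map_ofNat, show (2 : ZMod 2) = 0 from rfl, zero_mul] at h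
    exact one_ne_zero h
  · intro h
    obtain ⟨x, hx⟩ := (even_or_odd c).resolve_left h
    exact ⟨x + 1, by linear_combination hx⟩

lemma card_not_even {n : ℕ} [NeZero n] (hn : Even n) :
    Nat.card {c : ZMod n // ¬ Even c} = n / 2 := by
  classical
  have hswap : Nat.card {c : ZMod n // ¬ Even c} = Nat.card {c : ZMod n // Even c} :=
    Nat.card_congr ((Equiv.addRight 1).subtypeEquiv fun c => (even_add_one_iff hn c).symm)
  have hsum := Nat.card_congr (Equiv.sumCompl fun c : ZMod n => Even c)
  rw [Nat.card_sum, Nat.card_zmod] at hsum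
  omega

end ZMod

namespace FinDigraph

variable {α : Type} {G : FinDigraph α}

/-- An identification of the vertices with `ZMod n` under which arcs are the steps `i → i + 1`. -/
def IsCyclicLabelling (G : FinDigraph α) {n : ℕ} (e : {x // x ∈ G.V} ≃ ZMod n) : Prop :=
  ∀ a b : {x // x ∈ G.V}, ((a : α), (b : α)) ∈ G.E ↔ e b = e a + 1

lemma existsUnique_succ [DecidableEq α] (h : IsCycleDigraph G) (a : {x // x ∈ G.V}) :
    ∃! b : {x // x ∈ G.V}, ((a : α), (b : α)) ∈ G.E := by
  obtain ⟨p, hp⟩ := Finset.card_eq_one.1 (h.2.2.2 a a.2).2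
  have hmem := fun q => Finset.ext_iff.1 hp q
  simp only [Finset.mem_filter, Finset.mem_singleton] at hmem
  obtain ⟨hpE, hpa⟩ := (hmem p).2 rfl
  refine ⟨⟨p.2, (h.1 p hpE).2.1⟩, by simpa [← hpa] using hpE, fun b hb => ?_⟩
  exact Subtype.ext (congrArg Prod.snd ((hmem _).1 ⟨hb, rfl⟩))

lemma eq_of_succ_eq [DecidableEq α] (h : IsCycleDigraph G) {a b c : {x // x ∈ G.V}}
    (ha : ((a : α), (c : α)) ∈ G.E) (hb : ((b : α), (c : α)) ∈ G.E) : a = b := by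
  have hle := (h.2.2.2 c c.2).1.le
  have := Finset.card_le_one.1 hle _ (Finset.mem_filter.2 ⟨ha, rfl⟩) _
    (Finset.mem_filter.2 ⟨hb, rfl⟩)
  exact Subtype.ext (congrArg Prod.fst this)

lemma exists_succ_perm [DecidableEq α] (h : IsCycleDigraph G) :
    ∃ f : Equiv.Perm {x // x ∈ G.V},
      ∀ a b : {x // x ∈ G.V}, ((a : α), (b : α)) ∈ G.E ↔ f a = b := by
  choose f hf huniq using existsUnique_succ h
  have hinj : Function.Injective f := fun a b hab =>
    eq_of_succ_eq h (hf a) (hab ▸ hf b)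
  refine ⟨Equiv.ofBijective f (Finite.injective_iff_bijective.1 hinj), fun a b => ?_⟩
  exact ⟨fun hab => (huniq a b hab).symm, fun hab => hab ▸ hf a⟩

lemma isCycleOn_succ [DecidableEq α] (h : IsCycleDigraph G) {f : Equiv.Perm {x // x ∈ G.V}}
    (hf : ∀ a b : {x // x ∈ G.V}, ((a : α), (b : α)) ∈ G.E ↔ f a = b) :
    f.IsCycleOn ((Finset.univ : Finset {x // x ∈ G.V}) : Set {x // x ∈ G.V}) := by
  refine ⟨by simpa using f.bijective, fun a _ b _ => ?_⟩
  have key : ∀ y, Relation.ReflTransGen (fun x y => (x, y) ∈ G.E) a.1 y →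
      ∃ hy : y ∈ G.V, f.SameCycle a ⟨y, hy⟩ := by
    intro y hy
    induction hy with
    | refl => exact ⟨a.2, Equiv.Perm.SameCycle.refl f a⟩
    | @tail b c _ hbc ih =>
      obtain ⟨hb, hab⟩ := ih
      have hc := (h.1 _ hbc).2.1
      refine ⟨hc, ?_⟩
      rw [← (hf ⟨b, hb⟩ ⟨c, hc⟩).1 hbc]
      exact Equiv.Perm.sameCycle_apply_right.2 hab
  exact (key b.1 (h.2.2.1 a a.2 b b.2)).2

lemma exists_isCyclicLabelling [DecidableEq α] (h : IsCycleDigraph G) :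
    ∃ e : {x // x ∈ G.V} ≃ ZMod G.V.card, G.IsCyclicLabelling e := by
  obtain ⟨f, hf⟩ := exists_succ_perm h
  have hcyc := isCycleOn_succ h hf
  have hpos : 0 < G.V.card := by have := h.2.1; omega
  have : NeZero G.V.card := ⟨hpos.ne'⟩
  obtain ⟨v, hv⟩ := Finset.card_pos.1 hpos
  choose i hi using fun a => hcyc.2 (Finset.mem_coe.2 (Finset.mem_univ ⟨v, hv⟩))
    (Finset.mem_coe.2 (Finset.mem_univ a))
  have hcard : (Finset.univ : Finset {x // x ∈ G.V}).card = G.V.card := by simp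
  have hpow : ∀ m k : ℤ, (f ^ m) ⟨v, hv⟩ = (f ^ k) ⟨v, hv⟩ ↔
      (m : ZMod G.V.card) = (k : ZMod G.V.card) := fun m k => by
    rw [ZMod.intCast_eq_intCast_iff, hcyc.zpow_apply_eq_zpow_apply (Finset.mem_univ _), hcard]
  have hinj : Function.Injective fun a => (i a : ZMod G.V.card) := fun a b hab => by
    rw [← hi a, ← hi b]
    exact (hpow _ _).2 hab
  have hbij := (Fintype.bijective_iff_injective_and_card _).2
    ⟨hinj, by rw [ZMod.card, Fintype.card_coe]⟩
  refine ⟨Equiv.ofBijective _ hbij, fun a b => ?_⟩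
  have hstep := hpow (1 + i a) (i b)
  rw [zpow_add, zpow_one, Equiv.Perm.mul_apply, hi, hi] at hstep
  rw [hf, hstep, Equiv.ofBijective_apply, Equiv.ofBijective_apply]
  push_cast
  rw [add_comm, eq_comm]

variable {n : ℕ} {e : {x // x ∈ G.V} ≃ ZMod n}

/-- In cyclic coordinates the skew-symmetries are the reflections `x ↦ c - x` with `c` not of
the form `x + x`. -/
lemma IsCyclicLabelling.isSkewSym_iff [NeZero n] (he : G.IsCyclicLabelling e)
    (σ : Equiv.Perm {x // x ∈ G.V}) :
    IsSkewSym G σ ↔ ∃ c : ZMod n, ¬ Even c ∧ ∀ v, e (σ v) = c - e v := by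
  constructor
  · rintro ⟨-, hfix, harc⟩
    have hrefl : ∀ v, e (σ v) = e (σ (e.symm 0)) - e v := by
      have hnat : ∀ k : ℕ, e (σ (e.symm k)) = e (σ (e.symm 0)) - k := by
        intro k
        induction k with
        | zero => simp
        | succ k ih =>
          have hstep := (he _ _).1 (harc (e.symm k) (e.symm (k + 1 : ℕ))
            ((he _ _).2 (by simp)))
          rw [ih] at hstep
          push_cast at hstep ⊢
          linear_combination -hstep
      intro v
      simpa using hnat (e v).val
    refine ⟨_, ?_, hrefl⟩
    rintro ⟨x, hx⟩
    apply hfix (e.symm x)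
    apply e.injective
    rw [hrefl, hx]
    simp
  · rintro ⟨c, hc, hσ⟩
    refine ⟨fun v => e.injective (by simp [hσ]), fun v hv => hc ⟨e v, ?_⟩, fun a b hab => ?_⟩
    · have := hσ v
      rw [hv] at this
      linear_combination -this
    · rw [he] at hab ⊢
      rw [hσ, hσ, hab]
      ring

lemma IsCyclicLabelling.card_isSkewSym [NeZero n] (he : G.IsCyclicLabelling e) :
    Nat.card {σ : Equiv.Perm {x // x ∈ G.V} // IsSkewSym G σ} =
      Nat.card {c : ZMod n // ¬ Even c} := by
  choose c hc hσ using fun σ : {σ // IsSkewSym G σ} => (he.isSkewSym_iff σ.1).1 σ.2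
  refine Nat.card_congr (Equiv.ofBijective (fun σ => ⟨c σ, hc σ⟩) ⟨fun σ τ hστ => ?_, ?_⟩)
  · refine Subtype.ext (Equiv.ext fun v => e.injective ?_)
    rw [hσ, hσ, show c σ = c τ from Subtype.ext_iff.1 hστ]
  · rintro ⟨d, hd⟩
    have hd' : ∀ v, e (((e.trans (Equiv.subLeft d)).trans e.symm) v) = d - e v := by simp
    refine ⟨⟨_, (he.isSkewSym_iff _).2 ⟨d, hd, hd'⟩⟩, Subtype.ext ?_⟩
    exact sub_left_injective ((hσ _ (e.symm 0)).symm.trans (hd' _))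

lemma IsCyclicLabelling.hasUnit [NeZero n] (he : G.IsCyclicLabelling e)
    {σ : Equiv.Perm {x // x ∈ G.V}} (hσ : IsSkewSym G σ) : HasUnit G σ := by
  obtain ⟨c, hc, h⟩ := (he.isSkewSym_iff σ).1 hσ
  obtain ⟨x, hx⟩ := c.even_or_odd.resolve_left hc
  refine ⟨e.symm x, (he _ _).2 ?_⟩
  rw [h, e.apply_symm_apply]
  linear_combination hx

end FinDigraph

theorem stmt3 (G : FinDigraph ℕ) (h : IsCycleDigraph G) :
    (Odd G.V.card → ¬ ∃ σ : Equiv.Perm {x // x ∈ G.V}, IsSkewSym G σ) ∧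
    (Even G.V.card →
      Nat.card {σ : Equiv.Perm {x // x ∈ G.V} // IsSkewSym G σ} = G.V.card / 2 ∧
      ∀ σ : Equiv.Perm {x // x ∈ G.V}, IsSkewSym G σ → HasUnit G σ) := by
  have : NeZero G.V.card := ⟨by have := h.2.1; omega⟩
  obtain ⟨e, he⟩ := FinDigraph.exists_isCyclicLabelling h
  refine ⟨?_, fun hn => ⟨he.card_isSkewSym.trans (ZMod.card_not_even hn), fun σ => he.hasUnit⟩⟩
  rintro hn ⟨σ, hσ⟩
  obtain ⟨c, hc, -⟩ := (he.isSkewSym_iff σ).1 hσ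
  exact hc (ZMod.even_of_odd hn c)
end

section
/- Let k ≥ 2 and let F be a minimally unsatisfiable 2-clause-set of deficiency k in which every variable has variable-degree at least 3. Then idg(F) is a nonlinear 2k-weak-double-cycle, i.e., a 2k-WDC in which no vertex has in-degree 1 and out-degree 1. -/
lemma Lit.compl_compl (x : Lit) : x.compl.compl = x := by
  simp [Lit.compl]

lemma Lit.compl_ne (x : Lit) : x.compl ≠ x := by
  simp [Lit.compl, Prod.ext_iff]

lemma Lit.compl_inj {x y : Lit} : x.compl = y.compl ↔ x = y := by
  simp [Lit.compl, Prod.ext_iff]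

lemma Lit.compl_eq_comm {x y : Lit} : x.compl = y ↔ x = y.compl := by
  rw [← Lit.compl_inj, Lit.compl_compl]

lemma Lit.fst_eq_iff {x y : Lit} : x.1 = y.1 ↔ x = y ∨ x = y.compl := by
  obtain ⟨n, b⟩ := x
  obtain ⟨m, c⟩ := y
  cases b <;> cases c <;> simp [Lit.compl]

lemma litVal_compl (φ : ℕ → Bool) (x : Lit) : LitVal φ x.compl = !LitVal φ x := by
  obtain ⟨n, b⟩ := x
  cases b <;> simp [LitVal, Lit.compl]

lemma mem_litsOf {F : Finset (Finset Lit)} {x : Lit} :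
    x ∈ litsOf F ↔ ∃ C ∈ F, x ∈ C ∨ x.compl ∈ C := by
  simp only [litsOf, varsOf, Finset.mem_product, Finset.mem_biUnion, Finset.mem_image,
    Finset.mem_univ, and_true]
  constructor
  · rintro ⟨C, hC, y, hy, h⟩
    rcases Lit.fst_eq_iff.1 h with rfl | rfl
    · exact ⟨C, hC, Or.inl hy⟩
    · exact ⟨C, hC, Or.inr hy⟩
  · rintro ⟨C, hC, h | h⟩
    · exact ⟨C, hC, x, h, rfl⟩
    · exact ⟨C, hC, _, h, rfl⟩

lemma card_litsOf (F : Finset (Finset Lit)) : (litsOf F).card = 2 * (varsOf F).card := by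
  simp [litsOf, mul_comm]

lemma exists_eq_insert {C : Finset Lit} {y : Lit} (hy : y ∈ C) (hC : C.card ≤ 2) :
    ∃ b, C = insert y {b} := by
  have h : (C.erase y).card ≤ 1 := by
    rw [Finset.card_erase_of_mem hy]
    omega
  rcases (C.erase y).eq_empty_or_nonempty with h0 | ⟨b, hb⟩
  · exact ⟨y, by rw [← Finset.insert_erase hy, h0]; simp⟩
  · refine ⟨b, ?_⟩
    have : C.erase y = {b} :=
      (Finset.eq_singleton_iff_unique_mem.2 ⟨hb, fun c hc => Finset.card_le_one.1 h c hc b hb⟩)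
    rw [← this, Finset.insert_erase hy]

/-- There is an arc from `a` to `b` in the implication digraph. -/
def Arc (F : Finset (Finset Lit)) (a b : Lit) : Prop := insert a.compl {b} ∈ F

lemma Arc.mirror {F : Finset (Finset Lit)} {a b : Lit} (h : Arc F a b) :
    Arc F b.compl a.compl := by
  unfold Arc at *
  rwa [Lit.compl_compl, Finset.pair_comm]

lemma arc_mirror_iff {F : Finset (Finset Lit)} {a b : Lit} :
    Arc F a b ↔ Arc F b.compl a.compl :=
  ⟨Arc.mirror, fun h => by simpa [Lit.compl_compl] using h.mirror⟩

lemma Arc.left_mem {F : Finset (Finset Lit)} {a b : Lit} (h : Arc F a b) : a ∈ litsOf F :=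
  mem_litsOf.2 ⟨_, h, by simp⟩

lemma Arc.right_mem {F : Finset (Finset Lit)} {a b : Lit} (h : Arc F a b) : b ∈ litsOf F :=
  mem_litsOf.2 ⟨_, h, by simp⟩

lemma mem_idg_E {F : Finset (Finset Lit)} {p : Lit × Lit} :
    p ∈ (idg F).E ↔ Arc F p.1 p.2 := by
  simp only [idg, Finset.mem_filter, Finset.mem_product]
  exact ⟨fun h => h.2, fun h => ⟨⟨h.left_mem, h.right_mem⟩, h⟩⟩

lemma pair_eq_pair_iff_arc {a b c d : Lit} :
    (insert a.compl {b} : Finset Lit) = insert c.compl {d} ↔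
      (a = c ∧ b = d) ∨ (a = d.compl ∧ b = c.compl) := by
  have := @Finset.coe_inj Lit {a.compl, b} {c.compl, d}
  rw [← this]
  push_cast
  rw [Set.pair_eq_pair_iff, Lit.compl_inj, Lit.compl_eq_comm]

/-- A walk of length `m` in the implication digraph. -/
def IsWalk (F : Finset (Finset Lit)) (p : ℕ → Lit) (m : ℕ) : Prop :=
  ∀ t < m, Arc F (p t) (p (t + 1))

/-- `b` can be reached from `a` by a walk of length `m`. -/
def Reach (F : Finset (Finset Lit)) (m : ℕ) (a b : Lit) : Prop :=
  ∃ p, IsWalk F p m ∧ p 0 = a ∧ p m = b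

lemma reach_zero (F : Finset (Finset Lit)) (a : Lit) : Reach F 0 a a :=
  ⟨fun _ => a, fun _ h => absurd h (by omega), rfl, rfl⟩

lemma Arc.reach {F : Finset (Finset Lit)} {a b : Lit} (h : Arc F a b) : Reach F 1 a b := by
  refine ⟨fun t => if t = 0 then a else b, fun t ht => ?_, by simp, by simp⟩
  obtain rfl : t = 0 := by omega
  simpa using h

lemma Reach.trans {F : Finset (Finset Lit)} {m n : ℕ} {a b c : Lit} (h : Reach F m a b)
    (h' : Reach F n b c) : Reach F (m + n) a c := by
  obtain ⟨p, hp, hp0, hpm⟩ := h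
  obtain ⟨q, hq, hq0, hqn⟩ := h'
  refine ⟨fun t => if t < m then p t else q (t - m), fun t ht => ?_, ?_, by simpa using hqn⟩
  · rcases lt_trichotomy (t + 1) m with h1 | h1 | h1
    · simpa [show t < m by omega, h1] using hp t (by omega)
    · have := hp t (by omega)
      rw [h1, hpm, ← hq0] at this
      simpa [show t < m by omega, h1] using this
    · have := hq (t - m) (by omega)
      rw [show t - m + 1 = t + 1 - m by omega] at this
      simpa [show ¬ t < m by omega, show ¬ t + 1 < m by omega] using this
  · by_cases h0 : 0 < m
    · simpa [h0] using hp0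
    · obtain rfl : m = 0 := by omega
      simp [hq0, ← hpm, hp0]

lemma Reach.mirror {F : Finset (Finset Lit)} {m : ℕ} {a b : Lit} (h : Reach F m a b) :
    Reach F m b.compl a.compl := by
  obtain ⟨p, hp, rfl, rfl⟩ := h
  refine ⟨fun t => (p (m - t)).compl, fun t ht => ?_, by simp, by simp⟩
  have := (hp (m - (t + 1)) (by omega)).mirror
  rwa [show m - (t + 1) + 1 = m - t by omega] at this

lemma IsWalk.reach {F : Finset (Finset Lit)} {p : ℕ → Lit} {m : ℕ} (h : IsWalk F p m)
    {s t : ℕ} (hst : s ≤ t) (ht : t ≤ m) : Reach F (t - s) (p s) (p t) :=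
  ⟨fun i => p (s + i), fun i hi => h (s + i) (by omega), rfl, by simp [hst]⟩

lemma exists_reach_compl {F : Finset (Finset Lit)} (hF : MU2 F) {x : Lit} (hx : x ∈ litsOf F) :
    ∃ m, Reach F m x x.compl := by
  classical
  by_contra hno
  obtain ⟨⟨-, hunsat, hmin⟩, hcard⟩ := hF
  set S : Set Lit := {y | ∃ m, Reach F m x y} with hS
  have hxS : x ∈ S := ⟨0, reach_zero F x⟩
  have hcons : ∀ y ∈ S, y.compl ∉ S := by
    rintro y ⟨m, hm⟩ ⟨n, hn⟩
    have := hn.mirror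
    rw [Lit.compl_compl] at this
    exact hno ⟨_, hm.trans this⟩
  have hclosed : ∀ y ∈ S, ∀ b, Arc F y b → b ∈ S := by
    rintro y ⟨m, hm⟩ b hb
    exact ⟨_, hm.trans hb.reach⟩
  obtain ⟨φ, hφ⟩ := hmin (F.filter (fun C => ∀ y ∈ C, y ∉ S ∧ y.compl ∉ S)) (by
    rw [Finset.filter_ssubset]
    obtain ⟨C, hC, h | h⟩ := mem_litsOf.1 hx
    · exact ⟨C, hC, fun h' => (h' x h).1 hxS⟩
    · exact ⟨C, hC, fun h' => (h' _ h).2 (by rwa [Lit.compl_compl])⟩)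
  let ψ : ℕ → Bool := fun n => if (n, true) ∈ S then true else if (n, false) ∈ S then false else φ n
  have hψS : ∀ y ∈ S, LitVal ψ y = true := by
    rintro ⟨n, b⟩ hy
    cases b
    · have := hcons _ hy
      simp only [Lit.compl, Bool.not_false] at this
      simp [LitVal, ψ, this, hy]
    · simp [LitVal, ψ, hy]
  have hψφ : ∀ y, y ∉ S → y.compl ∉ S → LitVal ψ y = LitVal φ y := by
    rintro ⟨n, b⟩ h1 h2
    cases b <;> simp only [Lit.compl, Bool.not_false, Bool.not_true] at h1 h2 <;>
      simp [LitVal, ψ, h1, h2]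
  refine hunsat ⟨ψ, fun C hC => ?_⟩
  by_cases hG : ∀ y ∈ C, y ∉ S ∧ y.compl ∉ S
  · obtain ⟨y, hy, hyφ⟩ := hφ C (Finset.mem_filter.2 ⟨hC, hG⟩)
    exact ⟨y, hy, by rw [hψφ y (hG y hy).1 (hG y hy).2, hyφ]⟩
  · push Not at hG
    obtain ⟨y, hy, h⟩ := hG
    by_cases hyS : y ∈ S
    · exact ⟨y, hy, hψS y hyS⟩
    · obtain ⟨b, hb⟩ := exists_eq_insert hy (hcard C hC)
      refine ⟨b, by simp [hb], hψS b (hclosed _ (h hyS) b ?_)⟩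
      rwa [Arc, Lit.compl_compl, ← hb]

/-- A walk of length `j` that ends in the complement of one of its vertices. -/
def IsLasso (F : Finset (Finset Lit)) (p : ℕ → Lit) (j : ℕ) : Prop :=
  IsWalk F p j ∧ ∃ i ≤ j, p j = (p i).compl

/-- The clauses traversed by a walk. -/
def walkClauses (p : ℕ → Lit) (j : ℕ) : Finset (Finset Lit) :=
  (Finset.range j).image (fun t => insert (p t).compl {p (t + 1)})

lemma card_walkClauses_le (p : ℕ → Lit) (j : ℕ) : (walkClauses p j).card ≤ j := by
  exact Finset.card_image_le.trans (Finset.card_range j).le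

lemma IsLasso.litVal_eq_false {F : Finset (Finset Lit)} {p : ℕ → Lit} {j : ℕ}
    (hp : IsLasso F p j) {φ : ℕ → Bool}
    (hφ : ∀ C ∈ walkClauses p j, ∃ x ∈ C, LitVal φ x = true) : LitVal φ (p 0) = false := by
  obtain ⟨-, i, hi, hij⟩ := hp
  by_contra h
  rw [Bool.not_eq_false] at h
  have key : ∀ t ≤ j, LitVal φ (p t) = true := by
    intro t
    induction t with
    | zero => exact fun _ => h
    | succ t ih =>
      intro ht
      obtain ⟨x, hx, hxφ⟩ := hφ _ (Finset.mem_image.2 ⟨t, Finset.mem_range.2 (by omega), rfl⟩)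
      rw [Finset.mem_insert, Finset.mem_singleton] at hx
      rcases hx with rfl | rfl
      · rw [litVal_compl, ih (by omega)] at hxφ
        simp at hxφ
      · exact hxφ
  have h1 := key j le_rfl
  rw [hij, litVal_compl, key i hi] at h1
  simp at h1

lemma MU.eq_walkClauses_union {F : Finset (Finset Lit)} (hF : MU F) {p q : ℕ → Lit} {j l : ℕ}
    (hp : IsLasso F p j) (hq : IsLasso F q l) (hpq : q 0 = (p 0).compl) :
    F = walkClauses p j ∪ walkClauses q l := by
  have hsub : walkClauses p j ∪ walkClauses q l ⊆ F := by
    refine Finset.union_subset ?_ ?_ <;> intro C hC <;> obtain ⟨t, ht, rfl⟩ := Finset.mem_image.1 hC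
    · exact hp.1 t (Finset.mem_range.1 ht)
    · exact hq.1 t (Finset.mem_range.1 ht)
  by_contra hne
  obtain ⟨φ, hφ⟩ := hF.2.2 _ (hsub.ssubset_of_ne (Ne.symm hne))
  have h1 := hp.litVal_eq_false (fun C hC => hφ C (Finset.mem_union_left _ hC))
  have h2 := hq.litVal_eq_false (fun C hC => hφ C (Finset.mem_union_right _ hC))
  rw [hpq, litVal_compl, h1] at h2
  simp at h2

lemma exists_short_lasso {F : Finset (Finset Lit)} (hF : MU2 F) {x : Lit} (hx : x ∈ litsOf F) :
    ∃ p j, p 0 = x ∧ IsLasso F p j ∧ j ≤ (varsOf F).card ∧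
      Set.InjOn (fun t => (p t).1) (Set.Iio j) := by
  classical
  have hex := exists_reach_compl hF hx
  obtain ⟨p, hp, hp0, hpm⟩ := Nat.find_spec hex
  set m := Nat.find hex with hm
  have hinj : ∀ s t, s < t → t ≤ m → p s ≠ p t := by
    intro s t hst ht h
    have h1 := hp.reach (Nat.zero_le s) (by omega)
    have h2 := hp.reach ht le_rfl
    rw [h] at h1
    rw [hpm] at h2
    rw [hp0] at h1
    exact Nat.find_min hex (m := s - 0 + (m - t)) (by omega) (h1.trans h2)
  have hex' : ∃ j, ∃ i ≤ j, p j = (p i).compl := ⟨m, 0, by omega, by rw [hpm, hp0]⟩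
  set j := Nat.find hex' with hj
  have hjm : j ≤ m := Nat.find_min' hex' ⟨0, by omega, by rw [hpm, hp0]⟩
  have hvar : ∀ s t, s < t → t < j → (p s).1 ≠ (p t).1 := by
    intro s t hst ht h
    rcases Lit.fst_eq_iff.1 h.symm with h | h
    · exact hinj s t hst (by omega) h.symm
    · exact Nat.find_min hex' ht ⟨s, hst.le, h⟩
  have hinjOn : Set.InjOn (fun t => (p t).1) (Set.Iio j) := by
    intro s hs t ht h
    rcases lt_trichotomy s t with h' | h' | h'
    · exact absurd h (hvar s t h' ht)
    · exact h'
    · exact absurd h.symm (hvar t s h' hs)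
  have hwalk : IsWalk F p j := fun t ht => hp t (by omega)
  refine ⟨p, j, hp0, ⟨hwalk, Nat.find_spec hex'⟩, ?_, hinjOn⟩
  have := Finset.card_le_card_of_injOn (s := Finset.range j) (t := varsOf F) (fun t => (p t).1)
    (fun t ht => by
      have := (hwalk t (by simpa using ht)).left_mem
      simp only [litsOf, Finset.mem_product] at this
      exact this.1) (by simpa using hinjOn)
  simpa using this

lemma MU2.card_le_of_reach {F : Finset (Finset Lit)} (hF : MU2 F) {x : Lit} {m : ℕ}
    (hx : x ∈ litsOf F) (h : Reach F m x x.compl) : F.card ≤ m + (varsOf F).card := by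
  obtain ⟨p, hp, hp0, hpm⟩ := h
  obtain ⟨q, l, hq0, hq, hl, -⟩ := exists_short_lasso hF (compl_mem hx)
  rw [hF.1.eq_walkClauses_union ⟨hp, 0, by omega, by rw [hpm, hp0]⟩ hq (by rw [hq0, hp0])]
  have := Finset.card_union_le (walkClauses p m) (walkClauses q l)
  have := card_walkClauses_le p m
  have := card_walkClauses_le q l
  rw [← hF.1.eq_walkClauses_union ⟨hp, 0, by omega, by rw [hpm, hp0]⟩ hq (by rw [hq0, hp0])] at *
  omega

lemma MU2.not_arc_compl {F : Finset (Finset Lit)} (hF : MU2 F)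
    (hd : (varsOf F).card + 2 ≤ F.card) (x : Lit) : ¬ Arc F x x.compl := by
  intro h
  have := hF.card_le_of_reach h.left_mem h.reach
  omega

lemma MU2.not_arc_self {F : Finset (Finset Lit)} (hF : MU2 F) (x : Lit) : ¬ Arc F x x :=
  fun h => hF.1.1 _ h x (by simp) (by simp)

/-- The out-neighbours of `a` in the implication digraph. -/
noncomputable def outN (F : Finset (Finset Lit)) (a : Lit) : Finset Lit :=
  open Classical in (litsOf F).filter (Arc F a)

lemma mem_outN {F : Finset (Finset Lit)} {a b : Lit} : b ∈ outN F a ↔ Arc F a b := by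
  simp only [outN, Finset.mem_filter]
  exact ⟨fun h => h.2, fun h => ⟨h.right_mem, h⟩⟩

lemma card_outN {F : Finset (Finset Lit)} (hF : ∀ C ∈ F, C.card ≤ 2) (a : Lit) :
    (outN F a).card = ldeg F a.compl := by
  have h : F.filter (fun C => a.compl ∈ C) = (outN F a).image (fun b => insert a.compl {b}) := by
    ext C
    simp only [Finset.mem_filter, Finset.mem_image, mem_outN]
    constructor
    · rintro ⟨hC, ha⟩
      obtain ⟨b, rfl⟩ := exists_eq_insert ha (hF C hC)
      exact ⟨b, hC, rfl⟩
    · rintro ⟨b, hb, rfl⟩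
      exact ⟨hb, by simp⟩
  rw [ldeg, h, Finset.card_image_of_injective]
  intro b c hbc
  rcases pair_eq_pair_iff_arc.1 hbc with h | h
  · exact h.2
  · rw [h.2, h.1, Lit.compl_compl]

lemma outDeg_idg (F : Finset (Finset Lit)) (a : Lit) : (idg F).outDeg a = (outN F a).card := by
  refine Finset.card_bij (fun p _ => p.2) ?_ ?_ ?_
  · rintro ⟨c, b⟩ h
    simp only [Finset.mem_filter, mem_idg_E] at h
    obtain ⟨h, rfl⟩ := h
    exact mem_outN.2 h
  · rintro ⟨c, b⟩ h ⟨c', b'⟩ h'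
    simp only [Finset.mem_filter] at h h'
    rintro rfl
    rw [h.2, h'.2]
  · intro b hb
    exact ⟨(a, b), by simpa [mem_idg_E] using mem_outN.1 hb, rfl⟩

lemma inDeg_idg (F : Finset (Finset Lit)) (a : Lit) :
    (idg F).inDeg a = (outN F a.compl).card := by
  refine Finset.card_bij (fun p _ => p.1.compl) ?_ ?_ ?_
  · rintro ⟨c, b⟩ h
    simp only [Finset.mem_filter, mem_idg_E] at h
    obtain ⟨h, rfl⟩ := h
    exact mem_outN.2 h.mirror
  · rintro ⟨c, b⟩ h ⟨c', b'⟩ h' heq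
    simp only [Finset.mem_filter] at h h'
    rw [Prod.mk.injEq, h.2, h'.2]
    exact ⟨Lit.compl_inj.1 heq, rfl⟩
  · intro b hb
    refine ⟨(b.compl, a), ?_, Lit.compl_compl b⟩
    have := (mem_outN.1 hb).mirror
    rw [Lit.compl_compl] at this
    simpa [mem_idg_E] using this

lemma MU2.card_outN_pos {F : Finset (Finset Lit)} (hF : MU2 F) {x : Lit} (hx : x ∈ litsOf F) :
    0 < (outN F x).card := by
  obtain ⟨m, p, hp, hp0, hpm⟩ := exists_reach_compl hF hx
  have hm : 0 < m := by
    rcases Nat.eq_zero_or_pos m with rfl | h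
    · exact absurd (hpm.symm.trans hp0) x.compl_ne
    · exact h
  exact Finset.card_pos.2 ⟨p 1, mem_outN.2 (hp0 ▸ hp 0 hm)⟩

lemma sum_ldeg (F : Finset (Finset Lit)) :
    ∑ x ∈ litsOf F, ldeg F x = ∑ C ∈ F, C.card := by
  unfold ldeg
  refine (Finset.sum_card_bipartiteAbove_eq_sum_card_bipartiteBelow (s := F) (t := litsOf F)
    (fun C x => x ∈ C)).symm.trans (Finset.sum_congr rfl fun C hC => ?_)
  congr 1
  ext x
  simp only [Finset.mem_bipartiteAbove, and_iff_right_iff_imp]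
  exact fun h => mem_litsOf.2 ⟨C, hC, Or.inl h⟩

/-- `a` and `b` are consecutive, in one of the two directions, on the walk `p` or its mirror. -/
def Consec (p : ℕ → Lit) (n : ℕ) (a b : Lit) : Prop :=
  ∃ t < n, (a = p t ∧ b = p (t + 1)) ∨ (a = p (t + 1) ∧ b = p t) ∨
    (a = (p t).compl ∧ b = (p (t + 1)).compl) ∨ (a = (p (t + 1)).compl ∧ b = (p t).compl)

lemma Consec.mirror {p : ℕ → Lit} {n : ℕ} {a b : Lit} (h : Consec p n a b) :
    Consec p n b.compl a.compl := by
  obtain ⟨t, ht, ⟨rfl, rfl⟩ | ⟨rfl, rfl⟩ | ⟨rfl, rfl⟩ | ⟨rfl, rfl⟩⟩ := h <;>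
    refine ⟨t, ht, ?_⟩ <;> simp [Lit.compl_compl]

section Shortest

variable {F : Finset (Finset Lit)} {p q : ℕ → Lit} {n : ℕ} (hp : IsWalk F p n) (hq : IsWalk F q n)
  (hpn : p n = (p 0).compl) (hq0 : q 0 = (p 0).compl) (hqn : q n = p 0)
  (hlits : ∀ y ∈ litsOf F, ∃ a ≤ n, y = p a ∨ y = (p a).compl)
  (hshort : ∀ y m, y ∈ litsOf F → Reach F m y y.compl → n ≤ m)

include hp hq hpn hq0 hqn hlits hshort in
lemma level_eq (m : ℕ) (hm : m ≤ n) (hy : q m ∈ litsOf F) :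
    q m = p (n - m) ∨ q m = (p m).compl := by
  have h1 := hq.reach hm le_rfl
  have h2 := (hq.reach (Nat.zero_le m) hm).mirror
  rw [hqn] at h1
  rw [hq0, Lit.compl_compl] at h2
  obtain ⟨a, ha, h | h⟩ := hlits _ hy
  · have h3 := (hp.reach ha le_rfl).mirror
    have h4 := hp.reach (Nat.zero_le a) ha
    rw [hpn, Lit.compl_compl, ← h] at h3
    rw [← h] at h4
    have h5 := hshort _ _ hy (h1.trans h3)
    have h6 := hshort _ _ (compl_mem hy) (by simpa [Lit.compl_compl] using h2.trans h4)
    left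
    rw [h]
    congr 1
    omega
  · have h3 := (hp.reach ha le_rfl).mirror
    have h4 := hp.reach (Nat.zero_le a) ha
    rw [hpn, Lit.compl_compl, ← h] at h3
    have h7 : p a = (q m).compl := by rw [h, Lit.compl_compl]
    rw [h7] at h4
    have h5 := hshort _ _ hy (h1.trans h4)
    have h6 := hshort _ _ (compl_mem hy) (by simpa [Lit.compl_compl] using h2.trans h3)
    right
    rw [h]
    congr 2
    omega

include hp hq hpn hq0 hqn hlits hshort in
lemma consec_of_shortest (m : ℕ) (hm : m < n) : Consec p n (q m) (q (m + 1)) := by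
  have harc := hq m hm
  have ha := level_eq hp hq hpn hq0 hqn hlits hshort m hm.le harc.left_mem
  have hb := level_eq hp hq hpn hq0 hqn hlits hshort (m + 1) hm harc.right_mem
  have hp0 : p 0 = (p n).compl := by rw [hpn, Lit.compl_compl]
  have e : n - m = n - (m + 1) + 1 := by omega
  rcases ha with ha | ha <;> rcases hb with hb | hb
  · exact ⟨n - (m + 1), by omega, Or.inr (Or.inl ⟨by rw [ha, e], hb⟩)⟩
  · rcases Nat.eq_zero_or_pos m with rfl | h0
    · exact ⟨0, by omega, Or.inr (Or.inr (Or.inl ⟨hq0, hb⟩))⟩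
    by_cases h1 : m + 1 = n
    · refine ⟨0, by omega, Or.inr (Or.inl ⟨?_, ?_⟩)⟩
      · rw [ha]
        congr 1
        omega
      · rw [hb, h1, hp0]
    · exfalso
      have h2 := hp.reach (s := 2) (t := n - m) (by omega) (by omega)
      have h3 := (hp.reach (s := 2) (t := m + 1) (by omega) (by omega)).mirror
      rw [← ha] at h2
      rw [← hb] at h3
      have := hshort _ _ (hp 2 (by omega)).left_mem ((h2.trans harc.reach).trans h3)
      omega
  · rcases Nat.eq_zero_or_pos m with rfl | h0
    · refine ⟨n - 1, by omega, Or.inr (Or.inl ⟨?_, hb⟩)⟩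
      rw [ha, show n - 1 + 1 = n by omega, hpn]
    by_cases h1 : m + 1 = n
    · refine ⟨n - 1, by omega, Or.inr (Or.inr (Or.inl ⟨?_, ?_⟩))⟩
      · rw [ha]
        congr 2
        omega
      · rw [hb, show n - (m + 1) = 0 by omega, hp0]
        congr 2
        omega
    · exfalso
      have h2 := (hp.reach (s := m) (t := n - 2) (by omega) (by omega)).mirror
      have h3 := hp.reach (s := n - (m + 1)) (t := n - 2) (by omega) (by omega)
      rw [← ha] at h2
      rw [← hb] at h3
      have := hshort _ _ (compl_mem (hp (n - 2) (by omega)).left_mem)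
        (by simpa [Lit.compl_compl] using (h2.trans harc.reach).trans h3)
      omega
  · exact ⟨m, hm, Or.inr (Or.inr (Or.inl ⟨ha, hb⟩))⟩

end Shortest

lemma mem_walkClauses_iff {p : ℕ → Lit} {j : ℕ} {a b : Lit} :
    (insert a.compl {b} : Finset Lit) ∈ walkClauses p j ↔
      ∃ t < j, (a = p t ∧ b = p (t + 1)) ∨ (a = (p (t + 1)).compl ∧ b = (p t).compl) := by
  simp only [walkClauses, Finset.mem_image, Finset.mem_range]
  refine exists_congr fun t => and_congr_right fun _ => ?_
  rw [eq_comm, pair_eq_pair_iff_arc]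

lemma isDoubleCycle_of_consec {F : Finset (Finset Lit)} {p : ℕ → Lit} {n : ℕ} (hn : 2 ≤ n)
    (hnF : (varsOf F).card = n) (hp : IsWalk F p n) (hpn : p n = (p 0).compl)
    (hinj : Set.InjOn (fun t => (p t).1) (Set.Iio n))
    (hcon : ∀ a b, Arc F a b → Consec p n a b) (hdeg : ∀ a ∈ litsOf F, 2 ≤ (outN F a).card) :
    IsDoubleCycle (2 * n) (idg F) := by
  set f : ℕ → Lit := fun j => if j ≤ n then p j else (p (j - n)).compl with hf
  have hf1 : ∀ t ≤ n, f t = p t := fun t ht => by simp [hf, ht]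
  have hf2 : ∀ t, f (n + t) = (p t).compl := by
    intro t
    rcases Nat.eq_zero_or_pos t with rfl | h
    · simp [hf, hpn]
    · simp [hf, h.ne']
  have hfn : f (2 * n) = f 0 := by
    rw [two_mul, hf2, hpn, Lit.compl_compl, hf1 0 (by omega)]
  have hmod : ∀ j < 2 * n, f ((j + 1) % (2 * n)) = f (j + 1) := by
    intro j hj
    rcases (show j + 1 < 2 * n ∨ j + 1 = 2 * n by omega) with h | h
    · rw [Nat.mod_eq_of_lt h]
    · rw [h, Nat.mod_self, hfn]
  have hmaps : ∀ j < 2 * n, f j ∈ litsOf F := by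
    intro j hj
    rcases lt_or_ge j n with h | h
    · rw [hf1 j h.le]
      exact (hp j h).left_mem
    · obtain ⟨t, rfl⟩ := Nat.exists_eq_add_of_le h
      rw [hf2]
      exact compl_mem (hp t (by omega)).left_mem
  have hpp : ∀ s t, s < n → t < n → p s ≠ (p t).compl := by
    intro s t hs ht h
    have := hinj hs ht (show (p s).1 = (p t).1 by rw [h]; rfl)
    rw [this] at h
    exact Lit.compl_ne _ h.symm
  have hfinj : Set.InjOn f ↑(Finset.range (2 * n)) := by
    intro i hi j hj hij
    simp only [Finset.coe_range, Set.mem_Iio] at hi hj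
    rcases lt_or_ge i n with h | h <;> rcases lt_or_ge j n with h' | h'
    · rw [hf1 i h.le, hf1 j h'.le] at hij
      exact hinj h h' (congrArg Prod.fst hij)
    · obtain ⟨t, rfl⟩ := Nat.exists_eq_add_of_le h'
      rw [hf1 i h.le, hf2] at hij
      exact absurd hij (hpp i t h (by omega))
    · obtain ⟨t, rfl⟩ := Nat.exists_eq_add_of_le h
      rw [hf1 j h'.le, hf2] at hij
      exact absurd hij.symm (hpp j t h' (by omega))
    · obtain ⟨t, rfl⟩ := Nat.exists_eq_add_of_le h
      obtain ⟨s, rfl⟩ := Nat.exists_eq_add_of_le h'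
      rw [hf2, hf2, Lit.compl_inj] at hij
      rw [hinj (show t < n by omega) (show s < n by omega) (congrArg Prod.fst hij)]
  have hmaps' : Set.MapsTo f ↑(Finset.range (2 * n)) ↑(litsOf F) := by
    intro j hj
    exact hmaps j (by simpa using hj)
  refine ⟨by omega, f, ⟨hmaps', hfinj, ?_⟩, ?_⟩
  · exact Finset.surjOn_of_injOn_of_card_le f hmaps' hfinj
      (by simp [idg, stdDoubleCycle, card_litsOf, hnF])
  · symm
    have hE : (idg F).E.card = ∑ a ∈ litsOf F, (outN F a).card := by
      rw [Finset.card_eq_sum_card_fiberwise (f := Prod.fst) (t := litsOf F)]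
      · exact Finset.sum_congr rfl fun a _ => outDeg_idg F a
      · intro x hx
        exact (mem_idg_E.1 hx).left_mem
    have hE' : 4 * n ≤ (idg F).E.card := by
      rw [hE]
      have := Finset.card_nsmul_le_sum (litsOf F) (fun a => (outN F a).card) 2 hdeg
      rw [card_litsOf, hnF, smul_eq_mul] at this
      omega
    refine Finset.eq_of_subset_of_card_le ?_ ?_
    · rintro ⟨a, b⟩ hab
      obtain ⟨t, ht, h⟩ := hcon a b (mem_idg_E.1 hab)
      simp only [stdDoubleCycle, Finset.mem_image, Finset.mem_biUnion, Finset.mem_range,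
        Finset.mem_insert, Finset.mem_singleton]
      rcases h with ⟨rfl, rfl⟩ | ⟨rfl, rfl⟩ | ⟨rfl, rfl⟩ | ⟨rfl, rfl⟩
      · refine ⟨_, ⟨t, by omega, Or.inl rfl⟩, ?_⟩
        simp only [hmod t (by omega), hf1 t (by omega), hf1 (t + 1) (by omega)]
      · refine ⟨_, ⟨t, by omega, Or.inr rfl⟩, ?_⟩
        simp only [hmod t (by omega), hf1 t (by omega), hf1 (t + 1) (by omega)]
      · refine ⟨_, ⟨n + t, by omega, Or.inl rfl⟩, ?_⟩
        simp only [hf2 t, (hmod (n + t) (by omega)).trans (hf2 (t + 1))]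
      · refine ⟨_, ⟨n + t, by omega, Or.inr rfl⟩, ?_⟩
        simp only [hf2 t, (hmod (n + t) (by omega)).trans (hf2 (t + 1))]
    · refine (Finset.card_image_le.trans ?_).trans hE'
      have := Finset.card_biUnion_le_card_mul (Finset.range (2 * n))
        (fun i => ({(i, (i + 1) % (2 * n)), ((i + 1) % (2 * n), i)} : Finset (ℕ × ℕ))) 2
        (fun i _ => Finset.card_le_two)
      rw [Finset.card_range] at this
      exact this.trans (by omega)

lemma MU2.isDoubleCycle_of_nonsingular {F : Finset (Finset Lit)} (hF : MU2 F)
    (hd : (varsOf F).card + 2 ≤ F.card) (hdeg : ∀ a ∈ litsOf F, 2 ≤ (outN F a).card) :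
    F.card = 2 * (varsOf F).card ∧ IsDoubleCycle (2 * (varsOf F).card) (idg F) ∧
      ∀ a, (outN F a).card ≤ 2 := by
  set n := (varsOf F).card with hn
  have hldeg : ∀ x ∈ litsOf F, 2 ≤ ldeg F x := by
    intro x hx
    have := hdeg _ (compl_mem hx)
    rwa [card_outN hF.2, Lit.compl_compl] at this
  have hsum_le : ∑ x ∈ litsOf F, ldeg F x ≤ 2 * F.card := by
    rw [sum_ldeg, mul_comm]
    exact Finset.sum_le_card_nsmul F _ 2 hF.2
  have hsum_ge : 4 * n ≤ ∑ x ∈ litsOf F, ldeg F x := by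
    have := Finset.card_nsmul_le_sum (litsOf F) (ldeg F) 2 hldeg
    rw [card_litsOf, smul_eq_mul, ← hn] at this
    linarith
  have hshort : ∀ y m, y ∈ litsOf F → Reach F m y y.compl → n ≤ m := by
    intro y m hy h
    have := hF.card_le_of_reach hy h
    omega
  have hlasso : ∀ x ∈ litsOf F, ∃ p, p 0 = x ∧ IsWalk F p n ∧ p n = x.compl ∧
      Set.InjOn (fun t => (p t).1) (Set.Iio n) := by
    intro x hx
    obtain ⟨p, j, hp0, ⟨hp, i, hi, hij⟩, hj, hinj⟩ := exists_short_lasso hF hx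
    have hij' := hp.reach hi le_rfl
    have hj0 : 0 < j := by
      rcases Nat.eq_zero_or_pos j with rfl | h
      · obtain rfl : i = 0 := by omega
        exact absurd hij.symm (Lit.compl_ne _)
      · exact h
    have him : p i ∈ litsOf F := by
      rcases Nat.eq_zero_or_pos i with rfl | h
      · exact hp0 ▸ hx
      · have := (hp (i - 1) (by omega)).right_mem
        rwa [Nat.sub_add_cancel h] at this
    rw [hij] at hij'
    have := hshort _ _ him hij'
    obtain rfl : i = 0 := by omega
    obtain rfl : j = n := by omega
    exact ⟨p, hp0, hp, by rw [hij, hp0], hinj⟩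
  have hne : (litsOf F).Nonempty := by
    rw [← Finset.card_pos, card_litsOf]
    by_contra h0
    have h0 : n = 0 := by omega
    rw [h0] at hd
    have hsub : F ⊆ {∅} := by
      intro C hC
      rw [Finset.mem_singleton, Finset.eq_empty_iff_forall_notMem]
      intro x hx
      have : x ∈ litsOf F := mem_litsOf.2 ⟨C, hC, Or.inl hx⟩
      have h1 := Finset.card_pos.2 ⟨x, this⟩
      rw [card_litsOf] at h1
      omega
    have := Finset.card_le_card hsub
    simp at this
    omega
  obtain ⟨x, hx⟩ := hne
  obtain ⟨p, hp0, hp, hpn, hinj⟩ := hlasso x hx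
  obtain ⟨q, hq0, hq, hqn, -⟩ := hlasso _ (compl_mem hx)
  rw [Lit.compl_compl] at hqn
  have hFeq := hF.1.eq_walkClauses_union (p := p) (q := q) (j := n) (l := n)
    ⟨hp, 0, by omega, by rw [hpn, hp0]⟩
    ⟨hq, 0, by omega, by rw [hqn, hq0, Lit.compl_compl]⟩ (by rw [hq0, hp0])
  have hcard : F.card = 2 * n := by
    have h1 := Finset.card_union_le (walkClauses p n) (walkClauses q n)
    have h2 := card_walkClauses_le p n
    have h3 := card_walkClauses_le q n
    rw [← hFeq] at h1
    omega
  have hlits : ∀ y ∈ litsOf F, ∃ a ≤ n, y = p a ∨ y = (p a).compl := by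
    intro y hy
    have hsurj := Finset.surjOn_of_injOn_of_card_le (s := Finset.range n) (t := varsOf F)
      (fun t => (p t).1) (fun t ht => by
        have := (hp t (by simpa using ht)).left_mem
        simp only [litsOf, Finset.mem_product] at this
        exact this.1) (by simpa using hinj) (by simp [hn])
    simp only [litsOf, Finset.mem_product] at hy
    obtain ⟨a, ha, h⟩ := hsurj hy.1
    refine ⟨a, (by simpa using ha : a < n).le, Lit.fst_eq_iff.1 h.symm⟩
  have hcon : ∀ a b, Arc F a b → Consec p n a b := by
    intro a b hab
    have : insert a.compl {b} ∈ F := hab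
    rw [hFeq, Finset.mem_union, mem_walkClauses_iff, mem_walkClauses_iff] at this
    rcases this with ⟨t, ht, h | h⟩ | ⟨t, ht, ⟨rfl, rfl⟩ | ⟨rfl, rfl⟩⟩
    · exact ⟨t, ht, Or.inl h⟩
    · exact ⟨t, ht, Or.inr (Or.inr (Or.inr h))⟩
    · exact consec_of_shortest hp hq (by rw [hpn, hp0]) (by rw [hq0, hp0]) (by rw [hqn, hp0])
        hlits hshort t ht
    · exact (consec_of_shortest hp hq (by rw [hpn, hp0]) (by rw [hq0, hp0]) (by rw [hqn, hp0])
        hlits hshort t ht).mirror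
  refine ⟨hcard, isDoubleCycle_of_consec (by omega) hn.symm hp (by rw [hpn, hp0]) hinj hcon hdeg,
    fun a => ?_⟩
  by_cases ha : a ∈ litsOf F
  · rw [card_outN hF.2]
    have h2 : ∑ x ∈ litsOf F, 2 = ∑ x ∈ litsOf F, ldeg F x := by
      refine le_antisymm (Finset.sum_le_sum hldeg) ?_
      rw [Finset.sum_const, card_litsOf, smul_eq_mul, ← hn]
      omega
    exact ((Finset.sum_eq_sum_iff_of_le hldeg).1 h2 _ (compl_mem ha)).ge
  · have : outN F a = ∅ := by
      rw [Finset.eq_empty_iff_forall_notMem]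
      exact fun b hb => ha (mem_outN.1 hb).left_mem
    simp [this]

/-- Renaming the vertices of a digraph. -/
def FinDigraph.relabel {α : Type} (π : Equiv.Perm α) (G : FinDigraph α) : FinDigraph α :=
  ⟨G.V.map π.toEmbedding, G.E.map (Equiv.prodCongr π π).toEmbedding⟩

lemma mem_relabel_V {α : Type} {π : Equiv.Perm α} {G : FinDigraph α} {a : α} :
    a ∈ (G.relabel π).V ↔ π.symm a ∈ G.V := by
  simp only [FinDigraph.relabel, Finset.mem_map_equiv]

lemma mem_relabel_E {α : Type} {π : Equiv.Perm α} {G : FinDigraph α} {a b : α} :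
    (a, b) ∈ (G.relabel π).E ↔ (π.symm a, π.symm b) ∈ G.E := by
  simp only [FinDigraph.relabel, Finset.mem_map_equiv, Equiv.prodCongr_symm, Equiv.prodCongr_apply,
    Prod.map_apply]

section Relabel

variable {α : Type} [DecidableEq α]

lemma splitVertex_iff {G G' : FinDigraph α} : SplitVertex G G' ↔
    ∃ x u v, x ∈ G.V ∧ u ∉ G.V ∧ v ∉ G.V ∧ u ≠ v ∧
      (∀ a, a ∈ G'.V ↔ a = u ∨ a = v ∨ (a ≠ x ∧ a ∈ G.V)) ∧
      (∀ a b, (a, b) ∈ G'.E ↔ (a = u ∧ b = v) ∨ ((a, b) ∈ G.E ∧ a ≠ x ∧ b ≠ x) ∨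
        ((a, x) ∈ G.E ∧ b = u) ∨ ((x, b) ∈ G.E ∧ a = v)) := by
  unfold SplitVertex
  refine exists_congr fun x => exists_congr fun u => exists_congr fun v =>
    and_congr_right fun _ => and_congr_right fun _ => and_congr_right fun _ =>
    and_congr_right fun _ => and_congr ?_ ?_
  · simp [Finset.ext_iff]
  · simp only [Finset.ext_iff, Prod.forall]
    refine forall_congr' fun a => forall_congr' fun b => iff_congr Iff.rfl ?_
    simp only [Finset.mem_insert, Finset.mem_union, Finset.mem_filter, Finset.mem_image,
      Prod.exists, Prod.mk.injEq]
    constructor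
    · rintro (h | (⟨h, h'⟩ | ⟨c, d, ⟨h, rfl⟩, rfl, rfl⟩) | ⟨c, d, ⟨h, rfl⟩, rfl, rfl⟩)
      · exact Or.inl h
      · exact Or.inr (Or.inl ⟨h, h'⟩)
      · exact Or.inr (Or.inr (Or.inl ⟨h, rfl⟩))
      · exact Or.inr (Or.inr (Or.inr ⟨h, rfl⟩))
    · rintro (h | ⟨h, h'⟩ | ⟨h, rfl⟩ | ⟨h, rfl⟩)
      · exact Or.inl h
      · exact Or.inr (Or.inl (Or.inl ⟨h, h'⟩))
      · exact Or.inr (Or.inl (Or.inr ⟨a, x, ⟨h, rfl⟩, rfl, rfl⟩))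
      · exact Or.inr (Or.inr ⟨x, b, ⟨h, rfl⟩, rfl, rfl⟩)

lemma splitArc_iff {G G' : FinDigraph α} : SplitArc G G' ↔
    ∃ x y v, (x, y) ∈ G.E ∧ v ∉ G.V ∧ (∀ a, a ∈ G'.V ↔ a = v ∨ a ∈ G.V) ∧
      (∀ a b, (a, b) ∈ G'.E ↔ (a = x ∧ b = v) ∨ (a = v ∧ b = y) ∨
        (¬ (a = x ∧ b = y) ∧ (a, b) ∈ G.E)) := by
  simp [SplitArc, Finset.ext_iff]

lemma SplitVertex.relabel (π : Equiv.Perm α) {G G' : FinDigraph α} (h : SplitVertex G G') :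
    SplitVertex (G.relabel π) (G'.relabel π) := by
  rw [splitVertex_iff] at h ⊢
  obtain ⟨x, u, v, hx, hu, hv, huv, hV, hE⟩ := h
  refine ⟨π x, π u, π v, ?_, ?_, ?_, ?_, ?_, ?_⟩ <;>
    simp only [mem_relabel_V, mem_relabel_E, hV, hE, Equiv.symm_apply_apply, Equiv.symm_apply_eq,
      ne_eq, EmbeddingLike.apply_eq_iff_eq, hx, hu, hv, huv, not_false_eq_true, implies_true]

lemma SplitArc.relabel (π : Equiv.Perm α) {G G' : FinDigraph α} (h : SplitArc G G') :
    SplitArc (G.relabel π) (G'.relabel π) := by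
  rw [splitArc_iff] at h ⊢
  obtain ⟨x, y, v, hxy, hv, hV, hE⟩ := h
  refine ⟨π x, π y, π v, ?_, ?_, ?_, ?_⟩ <;>
    simp only [mem_relabel_V, mem_relabel_E, hV, hE, Equiv.symm_apply_apply, Equiv.symm_apply_eq,
      hxy, hv, not_false_eq_true, implies_true]

lemma IsDoubleCycle.relabel (π : Equiv.Perm α) {m : ℕ} {G : FinDigraph α}
    (h : IsDoubleCycle m G) : IsDoubleCycle m (G.relabel π) := by
  obtain ⟨hm, f, hV, hE⟩ := h
  refine ⟨hm, π ∘ f, ?_, ?_⟩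
  · have : Set.BijOn π ↑G.V ↑(G.relabel π).V := by
      simpa [FinDigraph.relabel] using π.injective.injOn.bijOn_image (s := (G.V : Set α))
    exact this.comp hV
  · simp only [FinDigraph.relabel, ← hE, Finset.map_eq_image, Finset.image_image]
    rfl

lemma IsWDC.relabel (π : Equiv.Perm α) {m : ℕ} {G : FinDigraph α} (h : IsWDC m G) :
    IsWDC m (G.relabel π) := by
  obtain ⟨G₀, h₀, h⟩ := h
  refine ⟨G₀.relabel π, h₀.relabel π, ?_⟩
  exact Relation.ReflTransGen.lift (p := fun A B => SplitVertex A B ∨ SplitArc A B)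
    (FinDigraph.relabel π) (fun A B hAB => hAB.imp (SplitVertex.relabel π) (SplitArc.relabel π))
    _ _ h

lemma IsWDC.splitVertex {m : ℕ} {G G' : FinDigraph α} (h : IsWDC m G) (h' : SplitVertex G G') :
    IsWDC m G' := by
  obtain ⟨G₀, h₀, h⟩ := h
  exact ⟨G₀, h₀, h.tail (Or.inl h')⟩

lemma IsWDC.splitArc {m : ℕ} {G G' : FinDigraph α} (h : IsWDC m G) (h' : SplitArc G G') :
    IsWDC m G' := by
  obtain ⟨G₀, h₀, h⟩ := h
  exact ⟨G₀, h₀, h.tail (Or.inr h')⟩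

/-- Splitting a vertex `x` into `u` and `v` where one of the new names may be `x` itself. -/
lemma IsWDC.split_reuse [Infinite α] {m : ℕ} {G G' : FinDigraph α} (h : IsWDC m G)
    (hG : G.WellFormed) {x u v : α} (hx : x ∈ G.V) (hu : u = x ∨ u ∉ G.V)
    (hv : v = x ∨ v ∉ G.V) (huv : u ≠ v)
    (hV : ∀ a, a ∈ G'.V ↔ a = u ∨ a = v ∨ (a ≠ x ∧ a ∈ G.V))
    (hE : ∀ a b, (a, b) ∈ G'.E ↔ (a = u ∧ b = v) ∨ ((a, b) ∈ G.E ∧ a ≠ x ∧ b ≠ x) ∨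
        ((a, x) ∈ G.E ∧ b = u) ∨ ((x, b) ∈ G.E ∧ a = v)) : IsWDC m G' ∧ G'.WellFormed := by
  obtain ⟨z, hz⟩ := Infinite.exists_notMem_finset (insert u (insert v G.V))
  simp only [Finset.mem_insert, not_or] at hz
  have hxz : x ≠ z := fun h => hz.2.2 (h ▸ hx)
  have hzE : ∀ a, (a, z) ∉ G.E ∧ (z, a) ∉ G.E :=
    fun a => ⟨fun h => hz.2.2 (hG _ h).2.1, fun h => hz.2.2 (hG _ h).1⟩
  have hs : ∀ a, (a = x ∧ Equiv.swap x z a = z) ∨ (a = z ∧ Equiv.swap x z a = x) ∨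
      (a ≠ x ∧ a ≠ z ∧ Equiv.swap x z a = a) := by
    intro a
    by_cases h1 : a = x
    · exact Or.inl ⟨h1, by simp [h1]⟩
    by_cases h2 : a = z
    · exact Or.inr (Or.inl ⟨h2, by simp [h2]⟩)
    · exact Or.inr (Or.inr ⟨h1, h2, Equiv.swap_apply_of_ne_of_ne h1 h2⟩)
  have hxx : (x, x) ∉ G.E := fun h => (hG _ h).2.2 rfl
  refine ⟨(h.relabel (Equiv.swap x z)).splitVertex (splitVertex_iff.2 ⟨z, u, v, ?_, ?_, ?_, huv,
    fun a => ?_, fun a b => ?_⟩), ?_⟩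
  · simpa [mem_relabel_V] using hx
  · rw [mem_relabel_V, Equiv.symm_swap]
    grind
  · rw [mem_relabel_V, Equiv.symm_swap]
    grind
  · rw [mem_relabel_V, Equiv.symm_swap, hV]
    have := hs a
    grind
  · simp only [mem_relabel_E, Equiv.symm_swap, hE, Equiv.swap_apply_right]
    have h1 := hs a
    have h2 := hs b
    have h3 := hzE a
    have h4 := hzE b
    have h5 := hzE x
    grind
  · rintro ⟨a, b⟩ hab
    have hG' : ∀ c d, (c, d) ∈ G.E → c ∈ G.V ∧ d ∈ G.V ∧ c ≠ d := fun c d h => hG _ h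
    simp only [hE] at hab
    simp only [hV]
    grind

end Relabel

lemma Sat.mono {F G : Finset (Finset Lit)} (h : Sat F) (hGF : G ⊆ F) : Sat G :=
  h.imp fun _ hφ C hC => hφ C (hGF hC)

lemma exists_update (φ : ℕ → Bool) (y : Lit) :
    ∃ ψ, LitVal ψ y = true ∧ ∀ x, x ≠ y → x ≠ y.compl → LitVal ψ x = LitVal φ x := by
  refine ⟨Function.update φ y.1 y.2, ?_, fun x h1 h2 => ?_⟩
  · by_cases h : y.2 <;> simp [LitVal, h]
  · have : x.1 ≠ y.1 := fun h => (Lit.fst_eq_iff.1 h).elim h1 h2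
    simp [LitVal, Function.update_of_ne this]

lemma MU.exists_model {F : Finset (Finset Lit)} (hF : MU F) {C : Finset Lit} (hC : C ∈ F) :
    ∃ φ, (∀ D ∈ F, D ≠ C → ∃ x ∈ D, LitVal φ x = true) ∧ ∀ x ∈ C, LitVal φ x = false := by
  obtain ⟨φ, hφ⟩ := hF.2.2 _ (Finset.erase_ssubset hC)
  have h1 : ∀ D ∈ F, D ≠ C → ∃ x ∈ D, LitVal φ x = true :=
    fun D hD hne => hφ D (Finset.mem_erase.2 ⟨hne, hD⟩)
  refine ⟨φ, h1, fun x hx => ?_⟩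
  by_contra h
  rw [Bool.not_eq_false] at h
  refine hF.2.1 ⟨φ, fun D hD => ?_⟩
  by_cases hne : D = C
  · exact ⟨x, hne ▸ hx, h⟩
  · exact h1 D hD hne

lemma MU2.mem_litsOf_iff {F : Finset (Finset Lit)} (hF : MU2 F) {x : Lit} :
    x ∈ litsOf F ↔ ∃ b, Arc F x b := by
  constructor
  · intro hx
    obtain ⟨b, hb⟩ := Finset.card_pos.1 (hF.card_outN_pos hx)
    exact ⟨b, mem_outN.1 hb⟩
  · rintro ⟨b, hb⟩
    exact hb.left_mem

lemma MU2.idg_wellFormed {F : Finset (Finset Lit)} (hF : MU2 F) : (idg F).WellFormed := by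
  rintro ⟨a, b⟩ h
  rw [mem_idg_E] at h
  refine ⟨h.left_mem, h.right_mem, ?_⟩
  rintro (rfl : a = b)
  exact hF.not_arc_self a h

/-- The result of resolving `{v, w}`, the only clause containing `v`, with all clauses that
contain the complement of `v`. -/
noncomputable def resolve (F : Finset (Finset Lit)) (v w : Lit) : Finset (Finset Lit) :=
  F.filter (fun C => v ∉ C ∧ v.compl ∉ C) ∪ (outN F v).image (fun b => insert w {b})

section Resolve

variable {F : Finset (Finset Lit)} {v w : Lit}

lemma arc_resolve {a b : Lit} : Arc (resolve F v w) a b ↔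
    (Arc F a b ∧ a ≠ v ∧ a ≠ v.compl ∧ b ≠ v ∧ b ≠ v.compl) ∨ (a = w.compl ∧ Arc F v b) ∨
      (b = w ∧ Arc F a v.compl) := by
  have h : ∀ c, (insert w {c} : Finset Lit) = insert a.compl {b} ↔
      (a = w.compl ∧ b = c) ∨ (b = w ∧ a = c.compl) := by
    intro c
    nth_rw 1 [← Lit.compl_compl w]
    rw [eq_comm, pair_eq_pair_iff_arc, Lit.compl_compl]
    tauto
  unfold Arc resolve
  simp only [Finset.mem_union, Finset.mem_filter, Finset.mem_image, mem_outN, h,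
    Finset.mem_insert, Finset.mem_singleton, Lit.compl_inj, not_or]
  refine or_congr ?_ ?_
  · rw [@eq_comm _ v a.compl, Lit.compl_eq_comm, @eq_comm _ v a, @eq_comm _ v b,
      @eq_comm _ v.compl b]
    tauto
  · change _ ↔ (a = w.compl ∧ Arc F v b) ∨ (b = w ∧ Arc F a v.compl)
    constructor
    · rintro ⟨c, hc, ⟨rfl, rfl⟩ | ⟨rfl, rfl⟩⟩
      · exact Or.inl ⟨rfl, hc⟩
      · exact Or.inr ⟨rfl, hc.mirror⟩
    · rintro (⟨rfl, hc⟩ | ⟨rfl, hc⟩)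
      · exact ⟨b, hc, Or.inl ⟨rfl, rfl⟩⟩
      · refine ⟨a.compl, ?_, Or.inr ⟨rfl, (Lit.compl_compl a).symm⟩⟩
        simpa [Lit.compl_compl] using Arc.mirror hc

variable (hF : MU2 F) (hd : (varsOf F).card + 2 ≤ F.card) (hv : ∀ b, Arc F v.compl b ↔ b = w)

include hv in
lemma arc_to_iff {a : Lit} : Arc F a v ↔ a = w.compl := by
  rw [arc_mirror_iff, hv, Lit.compl_eq_comm]

include hv in
lemma eq_of_mem_clause {C : Finset Lit} (hF : MU2 F) (hC : C ∈ F) (h : v ∈ C) :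
    C = insert v {w} := by
  obtain ⟨c, rfl⟩ := exists_eq_insert h (hF.2 C hC)
  have : Arc F v.compl c := by rwa [Arc, Lit.compl_compl]
  rw [(hv c).1 this]

lemma exists_arc_of_mem_clause {C : Finset Lit} (hF : MU2 F) (hC : C ∈ F) (h : v.compl ∈ C) :
    ∃ b, C = insert v.compl {b} ∧ Arc F v b := by
  obtain ⟨c, rfl⟩ := exists_eq_insert h (hF.2 C hC)
  exact ⟨c, rfl, hC⟩

include hF hd hv in
lemma ne_pivot : w ≠ v ∧ w ≠ v.compl := by
  have h := (hv w).2 rfl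
  constructor
  · rintro rfl
    exact hF.not_arc_compl hd w.compl (by rwa [Lit.compl_compl])
  · rintro rfl
    exact hF.not_arc_self _ h

include hF hd in
lemma ne_of_arc {b : Lit} (hb : Arc F v b) : b ≠ v ∧ b ≠ v.compl := by
  constructor
  · rintro rfl
    exact hF.not_arc_self _ hb
  · rintro rfl
    exact hF.not_arc_compl hd _ hb

include hF hd hv in
lemma exists_model_of_arc {b : Lit} (hb : Arc F v b) :
    ∃ φ, (∀ D ∈ F, D ≠ insert v.compl {b} → ∃ x ∈ D, LitVal φ x = true) ∧
      LitVal φ v = true ∧ LitVal φ b = false ∧ LitVal φ w = false := by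
  obtain ⟨φ, h1, h2⟩ := hF.1.exists_model hb
  have hφv : LitVal φ v = true := by
    have := h2 v.compl (by simp)
    rwa [litVal_compl, Bool.not_eq_false'] at this
  refine ⟨φ, h1, hφv, h2 b (by simp), ?_⟩
  by_contra hw
  rw [Bool.not_eq_false] at hw
  obtain ⟨ψ, hψ1, hψ2⟩ := exists_update φ v.compl
  rw [Lit.compl_compl] at hψ2
  obtain ⟨hwv, hwv'⟩ := ne_pivot hF hd hv
  refine hF.1.2.1 ⟨ψ, fun C hC => ?_⟩
  by_cases hCv' : v.compl ∈ C
  · exact ⟨_, hCv', hψ1⟩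
  by_cases hCv : v ∈ C
  · exact ⟨w, by rw [eq_of_mem_clause hv hF hC hCv]; simp, by rw [hψ2 w hwv' hwv, hw]⟩
  · obtain ⟨x, hx, hxφ⟩ := h1 C hC (by rintro rfl; simp at hCv')
    exact ⟨x, hx, by rw [hψ2 x (by grind) (by grind), hxφ]⟩

include hF hd hv in
lemma not_arc_of_arc {b : Lit} (hb : Arc F v b) : b ≠ w.compl ∧ ¬ Arc F w.compl b := by
  obtain ⟨φ, h1, h2, h3, h4⟩ := exists_model_of_arc hF hd hv hb
  constructor
  · rintro rfl
    rw [litVal_compl, h4] at h3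
    simp at h3
  · intro h
    rw [Arc, Lit.compl_compl] at h
    obtain ⟨hwv, hwv'⟩ := ne_pivot hF hd hv
    have hne : (insert w {b} : Finset Lit) ≠ insert v.compl {b} := by
      intro h
      have h5 : v.compl ∈ (insert w {b} : Finset Lit) := by rw [h]; simp
      have h6 := (ne_of_arc hF hd hb).2
      simp only [Finset.mem_insert, Finset.mem_singleton] at h5
      exact h5.elim (fun h => hwv' h.symm) (fun h => h6 h.symm)
    obtain ⟨x, hx, hxφ⟩ := h1 _ h hne
    simp only [Finset.mem_insert, Finset.mem_singleton] at hx
    rcases hx with rfl | rfl <;> simp_all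

include hF hd hv in
lemma not_sat_resolve : ¬ Sat (resolve F v w) := by
  rintro ⟨φ, hφ⟩
  obtain ⟨hwv, hwv'⟩ := ne_pivot hF hd hv
  have hrest : ∀ C ∈ F, v ∉ C → v.compl ∉ C → ∃ x ∈ C, LitVal φ x = true :=
    fun C hC h1 h2 => hφ C (Finset.mem_union_left _ (Finset.mem_filter.2 ⟨hC, h1, h2⟩))
  by_cases hw : LitVal φ w = true
  · obtain ⟨ψ, hψ1, hψ2⟩ := exists_update φ v.compl
    rw [Lit.compl_compl] at hψ2
    refine hF.1.2.1 ⟨ψ, fun C hC => ?_⟩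
    by_cases hCv' : v.compl ∈ C
    · exact ⟨_, hCv', hψ1⟩
    by_cases hCv : v ∈ C
    · exact ⟨w, by rw [eq_of_mem_clause hv hF hC hCv]; simp, by rw [hψ2 w hwv' hwv, hw]⟩
    · obtain ⟨x, hx, hxφ⟩ := hrest C hC hCv hCv'
      exact ⟨x, hx, by rw [hψ2 x (by grind) (by grind), hxφ]⟩
  · obtain ⟨ψ, hψ1, hψ2⟩ := exists_update φ v
    refine hF.1.2.1 ⟨ψ, fun C hC => ?_⟩
    by_cases hCv : v ∈ C
    · exact ⟨_, hCv, hψ1⟩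
    by_cases hCv' : v.compl ∈ C
    · obtain ⟨b, rfl, hb⟩ := exists_arc_of_mem_clause hF hC hCv'
      obtain ⟨x, hx, hxφ⟩ := hφ (insert w {b})
        (Finset.mem_union_right _ (Finset.mem_image.2 ⟨b, mem_outN.2 hb, rfl⟩))
      simp only [Finset.mem_insert, Finset.mem_singleton] at hx
      rcases hx with rfl | rfl
      · exact absurd hxφ hw
      · obtain ⟨h5, h6⟩ := ne_of_arc hF hd hb
        exact ⟨x, by simp, by rw [hψ2 x h5 h6, hxφ]⟩
    · obtain ⟨x, hx, hxφ⟩ := hrest C hC hCv hCv'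
      exact ⟨x, hx, by rw [hψ2 x (by grind) (by grind), hxφ]⟩

include hF hd hv in
lemma MU2.resolve : MU2 (resolve F v w) := by
  obtain ⟨hwv, hwv'⟩ := ne_pivot hF hd hv
  refine ⟨⟨?_, not_sat_resolve hF hd hv, ?_⟩, ?_⟩
  · intro C hC
    rcases Finset.mem_union.1 hC with h | h
    · exact hF.1.1 C (Finset.mem_filter.1 h).1
    · obtain ⟨b, hb, rfl⟩ := Finset.mem_image.1 h
      have h1 := (not_arc_of_arc hF hd hv (mem_outN.1 hb)).1
      intro x hx hx'
      simp only [Finset.mem_insert, Finset.mem_singleton] at hx hx'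
      rcases hx with rfl | rfl <;> rcases hx' with h2 | h2
      · exact Lit.compl_ne _ h2
      · exact h1 h2.symm
      · exact h1 (Lit.compl_eq_comm.1 h2)
      · exact Lit.compl_ne _ h2
  · intro G hG
    obtain ⟨E, hE, hEG⟩ := Finset.exists_of_ssubset hG
    have hsub : G ⊆ (_root_.resolve F v w).erase E :=
      fun C hC => Finset.mem_erase.2 ⟨fun h => hEG (h ▸ hC), hG.1 hC⟩
    refine Sat.mono ?_ hsub
    rcases Finset.mem_union.1 hE with h | h
    · obtain ⟨hEF, hvE, hvE'⟩ := Finset.mem_filter.1 h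
      obtain ⟨φ, hφ, -⟩ := hF.1.exists_model hEF
      refine ⟨φ, fun D hD => ?_⟩
      obtain ⟨hDE, hD⟩ := Finset.mem_erase.1 hD
      rcases Finset.mem_union.1 hD with h | h
      · exact hφ D (Finset.mem_filter.1 h).1 hDE
      · obtain ⟨b, hb, rfl⟩ := Finset.mem_image.1 h
        obtain ⟨x, hx, hxφ⟩ := hφ _ (mem_outN.1 hb) (by rintro rfl; simp at hvE')
        obtain ⟨y, hy, hyφ⟩ := hφ (insert v {w})
          (by simpa [Arc, Lit.compl_compl] using (hv w).2 rfl) (by rintro rfl; simp at hvE)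
        simp only [Finset.mem_insert, Finset.mem_singleton] at hx hy
        rcases hx with rfl | rfl
        · rcases hy with rfl | rfl
          · rw [litVal_compl, hyφ] at hxφ
            simp at hxφ
          · exact ⟨y, by simp, hyφ⟩
        · exact ⟨x, by simp, hxφ⟩
    · obtain ⟨b, hb, rfl⟩ := Finset.mem_image.1 h
      obtain ⟨φ, h1, h2, -, -⟩ := exists_model_of_arc hF hd hv (mem_outN.1 hb)
      refine ⟨φ, fun D hD => ?_⟩
      obtain ⟨hDE, hD⟩ := Finset.mem_erase.1 hD
      rcases Finset.mem_union.1 hD with h | h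
      · obtain ⟨hDF, -, hvD⟩ := Finset.mem_filter.1 h
        exact h1 D hDF (by rintro rfl; simp at hvD)
      · obtain ⟨c, hc, rfl⟩ := Finset.mem_image.1 h
        obtain ⟨x, hx, hxφ⟩ := h1 _ (mem_outN.1 hc) (by
          intro heq
          rcases pair_eq_pair_iff_arc.1 heq with h | h
          · exact hDE (by rw [h.2])
          · exact (ne_of_arc hF hd (mem_outN.1 hc)).2 h.2)
        simp only [Finset.mem_insert, Finset.mem_singleton] at hx
        rcases hx with rfl | rfl
        · rw [litVal_compl, h2] at hxφ
          simp at hxφ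
        · exact ⟨x, by simp, hxφ⟩
  · intro C hC
    rcases Finset.mem_union.1 hC with h | h
    · exact hF.2 C (Finset.mem_filter.1 h).1
    · obtain ⟨b, hb, rfl⟩ := Finset.mem_image.1 h
      exact Finset.card_le_two

include hF hd hv in
lemma mem_litsOf_resolve {x : Lit} :
    x ∈ litsOf (resolve F v w) ↔ x ∈ litsOf F ∧ x ≠ v ∧ x ≠ v.compl := by
  obtain ⟨hwv, hwv'⟩ := ne_pivot hF hd hv
  have hvw := (hv w).2 rfl
  rw [(hF.resolve hd hv).mem_litsOf_iff]
  simp only [arc_resolve]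
  constructor
  · rintro ⟨b, ⟨h, h1, h2, -, -⟩ | ⟨rfl, h⟩ | ⟨rfl, h⟩⟩
    · exact ⟨h.left_mem, h1, h2⟩
    · exact ⟨compl_mem hvw.right_mem, fun h => hwv' (Lit.compl_eq_comm.1 h),
        fun h => hwv (Lit.compl_inj.1 h)⟩
    · refine ⟨h.left_mem, ?_, ?_⟩
      · rintro rfl
        exact hF.not_arc_compl hd _ h
      · rintro rfl
        exact hF.not_arc_self _ h
  · rintro ⟨hx, h1, h2⟩
    obtain ⟨b, hb⟩ := hF.mem_litsOf_iff.1 hx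
    by_cases hbv : b = v
    · subst hbv
      obtain ⟨c, hc⟩ := hF.mem_litsOf_iff.1 hb.right_mem
      exact ⟨c, Or.inr (Or.inl ⟨(arc_to_iff hv).1 hb, hc⟩)⟩
    by_cases hbv' : b = v.compl
    · subst hbv'
      exact ⟨w, Or.inr (Or.inr ⟨rfl, hb⟩)⟩
    · exact ⟨b, Or.inl ⟨hb, h1, h2, hbv, hbv'⟩⟩

include hF hd hv in
lemma card_varsOf_resolve : (varsOf (resolve F v w)).card + 1 = (varsOf F).card := by
  have h : litsOf (resolve F v w) = ((litsOf F).erase v).erase v.compl := by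
    ext x
    rw [mem_litsOf_resolve hF hd hv, Finset.mem_erase, Finset.mem_erase]
    tauto
  have hvl : v.compl ∈ litsOf F := ((hv w).2 rfl).left_mem
  have hvl' : v ∈ litsOf F := by simpa [Lit.compl_compl] using compl_mem hvl
  have h1 := congrArg Finset.card h
  have h2 := Finset.card_erase_add_one (Finset.mem_erase.2 ⟨v.compl_ne, hvl⟩)
  have h3 := Finset.card_erase_add_one hvl'
  rw [← h1, card_litsOf] at h2
  rw [card_litsOf] at h3
  omega

include hF hd hv in
lemma card_resolve : (resolve F v w).card + 1 = F.card := by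
  have hdis : Disjoint (F.filter (fun C => v ∉ C ∧ v.compl ∉ C))
      ((outN F v).image (fun b => insert w {b})) := by
    rw [Finset.disjoint_right]
    intro C hC hC'
    obtain ⟨b, hb, rfl⟩ := Finset.mem_image.1 hC
    refine (not_arc_of_arc hF hd hv (mem_outN.1 hb)).2 ?_
    rw [Arc, Lit.compl_compl]
    exact (Finset.mem_filter.1 hC').1
  have himg : ((outN F v).image (fun b => (insert w {b} : Finset Lit))).card
      = (outN F v).card := by
    refine Finset.card_image_of_injective _ fun b c hbc => ?_
    rw [← Lit.compl_compl w] at hbc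
    rcases pair_eq_pair_iff_arc.1 hbc with h | h
    · exact h.2
    · rw [h.2, h.1, Lit.compl_compl]
  have hneg : F.filter (fun C => ¬ (v ∉ C ∧ v.compl ∉ C)) =
      F.filter (fun C => v ∈ C) ∪ F.filter (fun C => v.compl ∈ C) := by
    rw [← Finset.filter_or]
    exact Finset.filter_congr fun C _ => by tauto
  have hdis' : Disjoint (F.filter (fun C => v ∈ C)) (F.filter (fun C => v.compl ∈ C)) := by
    rw [Finset.disjoint_left]
    intro C hC hC'
    rw [Finset.mem_filter] at hC hC'
    exact hF.1.1 C hC.1 v hC.2 hC'.2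
  have hsplit := Finset.card_filter_add_card_filter_not (s := F)
    (fun C => v ∉ C ∧ v.compl ∉ C)
  have h1 : (outN F v.compl).card = (F.filter (fun C => v ∈ C)).card := by
    rw [card_outN hF.2, Lit.compl_compl, ldeg]
  have h2 : (outN F v).card = (F.filter (fun C => v.compl ∈ C)).card := by
    rw [card_outN hF.2, ldeg]
  have h3 : outN F v.compl = {w} := by
    ext b
    rw [mem_outN, hv, Finset.mem_singleton]
  rw [h3, Finset.card_singleton] at h1
  rw [hneg, Finset.card_union_of_disjoint hdis', ← h1, ← h2] at hsplit
  rw [resolve, Finset.card_union_of_disjoint hdis, himg]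
  omega

include hF hd hv in
lemma ne_of_arc_pivot {b : Lit} (hb : Arc F v b) : b ≠ w := by
  rintro rfl
  refine (hF.resolve hd hv).not_arc_compl ?_ b.compl ?_
  · have := card_varsOf_resolve hF hd hv
    have := card_resolve hF hd hv
    omega
  · rw [Lit.compl_compl, arc_resolve]
    exact Or.inr (Or.inl ⟨rfl, hb⟩)

end Resolve

section Expand

variable {F : Finset (Finset Lit)} {v w : Lit}
  (hF : MU2 F) (hd : (varsOf F).card + 2 ≤ F.card) (hv : ∀ b, Arc F v.compl b ↔ b = w)

include hF hd hv

lemma card_outN_add_le :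
    (outN F v).card + (outN F w.compl).card ≤ (outN (resolve F v w) w.compl).card + 1 := by
  obtain ⟨hwv, hwv'⟩ := ne_pivot hF hd hv
  have hvmem : v ∈ outN F w.compl := mem_outN.2 ((arc_to_iff hv).2 rfl)
  have hdis : Disjoint (outN F v) ((outN F w.compl).erase v) := by
    rw [Finset.disjoint_left]
    intro b hb hb'
    exact (not_arc_of_arc hF hd hv (mem_outN.1 hb)).2 (mem_outN.1 (Finset.mem_erase.1 hb').2)
  have hsub : outN F v ∪ (outN F w.compl).erase v ⊆ outN (resolve F v w) w.compl := by
    intro b hb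
    rw [mem_outN, arc_resolve]
    rcases Finset.mem_union.1 hb with h | h
    · exact Or.inr (Or.inl ⟨rfl, mem_outN.1 h⟩)
    · obtain ⟨h1, h2⟩ := Finset.mem_erase.1 h
      refine Or.inl ⟨mem_outN.1 h2, fun h => hwv' (Lit.compl_eq_comm.1 h),
        fun h => hwv (Lit.compl_inj.1 h), h1, ?_⟩
      rintro rfl
      have := (mem_outN.1 h2).mirror
      rw [Lit.compl_compl, Lit.compl_compl] at this
      exact ne_of_arc_pivot hF hd hv this rfl
  have h1 := Finset.card_le_card hsub
  rw [Finset.card_union_of_disjoint hdis] at h1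
  have h2 := Finset.card_erase_add_one hvmem
  omega

lemma card_outN_le_resolve {a : Lit} (h1 : a ≠ v) (h2 : a ≠ v.compl) (h3 : a ≠ w.compl) :
    (outN F a).card ≤ (outN (resolve F v w) a).card := by
  have hvw : ∀ b, Arc F a b → b ≠ v := by
    rintro b hb rfl
    exact h3 ((arc_to_iff hv).1 hb)
  have hnot : Arc F a v.compl → ¬ Arc F a w := by
    intro h h'
    have := h.mirror
    rw [Lit.compl_compl] at this
    exact (not_arc_of_arc hF hd hv this).2 h'.mirror
  refine Finset.card_le_card_of_injOn (fun b => if b = v.compl then w else b) ?_ ?_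
  · intro b hb
    have hb := mem_outN.1 hb
    simp only [Finset.mem_coe, mem_outN, arc_resolve]
    split_ifs with hbv
    · subst hbv
      exact Or.inr (Or.inr ⟨rfl, hb⟩)
    · exact Or.inl ⟨hb, h1, h2, hvw b hb, hbv⟩
  · intro b hb c hc hbc
    have hb := mem_outN.1 hb
    have hc := mem_outN.1 hc
    dsimp only at hbc
    split_ifs at hbc <;> grind

lemma card_outN_le_two_of_resolve (h : ∀ a, (outN (resolve F v w) a).card ≤ 2) (a : Lit) :
    (outN F a).card ≤ 2 := by
  have hle := card_outN_add_le hF hd hv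
  have hw := h w.compl
  have hvl : v.compl ∈ litsOf F := ((hv w).2 rfl).left_mem
  have hvpos := hF.card_outN_pos (x := v) (by simpa [Lit.compl_compl] using compl_mem hvl)
  have hwpos := hF.card_outN_pos (x := w.compl) (compl_mem ((hv w).2 rfl).right_mem)
  by_cases h1 : a = v
  · subst h1; omega
  by_cases h2 : a = v.compl
  · have h3 : outN F v.compl = {w} := by
      ext b
      rw [mem_outN, hv, Finset.mem_singleton]
    rw [h2, h3, Finset.card_singleton]
    omega
  by_cases h3 : a = w.compl
  · subst h3; omega
  · exact (card_outN_le_resolve hF hd hv h1 h2 h3).trans (h a)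

lemma isWDC_of_resolve_splitArc {m : ℕ} (h : IsWDC m (idg (resolve F v w))) {y : Lit}
    (hy : ∀ b, Arc F v b ↔ b = y) : IsWDC m (idg F) := by
  obtain ⟨hwv, hwv'⟩ := ne_pivot hF hd hv
  have hvy := (hy y).2 rfl
  obtain ⟨hyv, hyv'⟩ := ne_of_arc hF hd hvy
  have hyw := ne_of_arc_pivot hF hd hv hvy
  obtain ⟨-, hwy⟩ := not_arc_of_arc hF hd hv hvy
  have hwy' : ¬ Arc F y.compl w := fun h => hwy (by simpa [Lit.compl_compl] using h.mirror)
  have hto : ∀ a, Arc F a v ↔ a = w.compl := fun a => arc_to_iff hv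
  have hto' : ∀ a, Arc F a v.compl ↔ a = y.compl := fun a => by
    rw [arc_mirror_iff, Lit.compl_compl, hy, Lit.compl_eq_comm]
  have hc : w.compl ≠ v ∧ w.compl ≠ v.compl ∧ y.compl ≠ v ∧ y.compl ≠ v.compl ∧
      y.compl ≠ w.compl := by
    simp only [ne_eq, Lit.compl_eq_comm, Lit.compl_compl]
    exact ⟨hwv', hwv, hyv', hyv, hyw⟩
  have hvc := v.compl_ne
  have hvl : v.compl ∈ litsOf F := ((hv w).2 rfl).left_mem
  have hvl' : v ∈ litsOf F := hvy.left_mem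
  have hE : ∀ a b, (a, b) ∈ (idg (resolve F v w)).E ↔
      (Arc F a b ∧ a ≠ v ∧ a ≠ v.compl ∧ b ≠ v ∧ b ≠ v.compl) ∨ (a = w.compl ∧ b = y) ∨
      (b = w ∧ a = y.compl) := fun a b => by
    rw [mem_idg_E, arc_resolve, hy, hto']
  have hV : ∀ a, a ∈ (idg (resolve F v w)).V ↔ a ∈ litsOf F ∧ a ≠ v ∧ a ≠ v.compl :=
    fun a => mem_litsOf_resolve hF hd hv
  have h1 := h.splitArc (G' := ⟨insert v (idg (resolve F v w)).V,
      insert (w.compl, v) (insert (v, y) ((idg (resolve F v w)).E.erase (w.compl, y)))⟩)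
    ⟨w.compl, y, v, by grind, by grind, rfl, rfl⟩
  refine h1.splitArc (splitArc_iff.2 ⟨y.compl, w, v.compl, ?_, ?_, ?_, ?_⟩)
  · simp only [Finset.mem_insert, Finset.mem_erase, Prod.mk.injEq, ne_eq, hE]
    grind
  · simp only [Finset.mem_insert, hV]
    grind
  · intro a
    simp only [Finset.mem_insert, hV]
    change a ∈ litsOf F ↔ _
    grind
  · intro a b
    simp only [Finset.mem_insert, Finset.mem_erase, Prod.mk.injEq, ne_eq, hE, mem_idg_E]
    have := hv b
    have := hy b
    have := hto a
    have := hto' a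
    grind

lemma isWDC_of_resolve_splitVertex {m : ℕ} (h : IsWDC m (idg (resolve F v w)))
    (hw : ∀ b, Arc F w.compl b ↔ b = v) : IsWDC m (idg F) := by
  obtain ⟨hwv, hwv'⟩ := ne_pivot hF hd hv
  have hto : ∀ a, Arc F a v ↔ a = w.compl := fun a => arc_to_iff hv
  have hto' : ∀ a, Arc F a w ↔ a = v.compl := fun a => by
    rw [arc_mirror_iff, hw, Lit.compl_inj.symm, Lit.compl_compl]
  have hfrom : ∀ b, Arc F v b → b ≠ v ∧ b ≠ v.compl ∧ b ≠ w ∧ b ≠ w.compl := fun b hb =>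
    ⟨(ne_of_arc hF hd hb).1, (ne_of_arc hF hd hb).2, ne_of_arc_pivot hF hd hv hb,
      (not_arc_of_arc hF hd hv hb).1⟩
  have hfrom' : ∀ a, Arc F a v.compl → a ≠ v ∧ a ≠ v.compl ∧ a ≠ w ∧ a ≠ w.compl := by
    intro a ha
    have ha' := ha.mirror
    rw [Lit.compl_compl] at ha'
    obtain ⟨h1, h2, h3, h4⟩ := hfrom _ ha'
    rw [ne_eq, Lit.compl_eq_comm] at h1 h3
    rw [ne_eq, Lit.compl_inj] at h2 h4
    exact ⟨h2, h1, h4, h3⟩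
  have hc : w.compl ≠ v ∧ w.compl ≠ v.compl := by
    simp only [ne_eq, Lit.compl_eq_comm, Lit.compl_compl]
    exact ⟨hwv', hwv⟩
  have hvc := v.compl_ne
  have hwc := w.compl_ne
  have hvl : v.compl ∈ litsOf F := ((hv w).2 rfl).left_mem
  have hwl : w ∈ litsOf F := ((hv w).2 rfl).right_mem
  have hwl' := compl_mem hwl
  have hvl' : v ∈ litsOf F := ((hw v).2 rfl).right_mem
  have hE : ∀ a b, (a, b) ∈ (idg (resolve F v w)).E ↔
      (Arc F a b ∧ a ≠ v ∧ a ≠ v.compl ∧ b ≠ v ∧ b ≠ v.compl) ∨ (a = w.compl ∧ Arc F v b) ∨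
      (b = w ∧ Arc F a v.compl) := fun a b => by
    rw [mem_idg_E, arc_resolve]
  have hV : ∀ a, a ∈ (idg (resolve F v w)).V ↔ a ∈ litsOf F ∧ a ≠ v ∧ a ≠ v.compl :=
    fun a => mem_litsOf_resolve hF hd hv
  have hE₁ : ∀ a b, (a, b) ∈ insert (w.compl, v)
      ((idg (resolve F v w)).E.filter (fun p => p.1 ≠ w.compl) ∪
        (outN F v).image (fun b => (v, b))) ↔
      (a = w.compl ∧ b = v) ∨ ((a, b) ∈ (idg (resolve F v w)).E ∧ a ≠ w.compl) ∨
        (a = v ∧ Arc F v b) := by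
    intro a b
    simp only [Finset.mem_insert, Finset.mem_union, Finset.mem_filter, Finset.mem_image,
      Prod.mk.injEq, mem_outN]
    grind
  obtain ⟨h1, h1'⟩ := h.split_reuse (G' := ⟨insert v (idg (resolve F v w)).V,
      insert (w.compl, v) ((idg (resolve F v w)).E.filter (fun p => p.1 ≠ w.compl) ∪
        (outN F v).image (fun b => (v, b)))⟩) (hF.resolve hd hv).idg_wellFormed
    (x := w.compl) (u := w.compl) (v := v) (by grind) (Or.inl rfl) (Or.inr (by grind)) hc.1
    (fun a => by
      simp only [Finset.mem_insert, hV]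
      grind)
    (fun a b => by
      simp only [hE₁, hE]
      have := hw b
      have := hto a
      have := hto' a
      have := hfrom b
      have := hfrom' a
      have := hw w.compl
      have := hfrom w.compl
      grind)
  refine (h1.split_reuse h1' (x := w) (u := v.compl) (v := w) ?_ (Or.inr ?_) (Or.inl rfl)
    (Ne.symm hwv') ?_ ?_).1
  · simp only [Finset.mem_insert, hV]
    grind
  · simp only [Finset.mem_insert, hV]
    grind
  · intro a
    change a ∈ litsOf F ↔ _
    simp only [Finset.mem_insert, hV]
    grind
  · intro a b
    simp only [hE₁, hE, mem_idg_E]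
    have := hv b
    have := hw b
    have := hto a
    have := hto' a
    have := hfrom b
    have := hfrom' a
    have := hfrom w
    have := hw w
    grind

end Expand

lemma MU2.isWDC_idg {k : ℕ} (hk : 2 ≤ k) {F : Finset (Finset Lit)} (hF : MU2 F)
    (hd : F.card = k + (varsOf F).card) :
    IsWDC (2 * k) (idg F) ∧ ∀ a, (outN F a).card ≤ 2 := by
  induction hn : (varsOf F).card generalizing F with
  | zero =>
    obtain ⟨C, hC, D, hD, hCD⟩ := Finset.one_lt_card.1 (show 1 < F.card by omega)
    have hempty : ∀ C ∈ F, C = ∅ := by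
      intro C hC
      by_contra hne
      obtain ⟨x, hx⟩ := Finset.nonempty_iff_ne_empty.2 hne
      have h := Finset.card_pos.2 ⟨x, mem_litsOf.2 ⟨C, hC, Or.inl hx⟩⟩
      rw [card_litsOf, hn] at h
      omega
    exact absurd ((hempty C hC).trans (hempty D hD).symm) hCD
  | succ n ih =>
    by_cases hdeg : ∀ a ∈ litsOf F, 2 ≤ (outN F a).card
    · obtain ⟨h1, h2, h3⟩ := hF.isDoubleCycle_of_nonsingular (by omega) hdeg
      obtain rfl : k = (varsOf F).card := by omega
      exact ⟨⟨_, h2, Relation.ReflTransGen.refl⟩, h3⟩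
    · push Not at hdeg
      obtain ⟨a, ha, ha'⟩ := hdeg
      obtain ⟨w, hw⟩ := Finset.card_eq_one.1
        (show (outN F a).card = 1 by have := hF.card_outN_pos ha; omega)
      obtain ⟨v, rfl⟩ : ∃ v : Lit, a = v.compl := ⟨a.compl, a.compl_compl.symm⟩
      have hv : ∀ b, Arc F v.compl b ↔ b = w := fun b => by
        rw [← mem_outN, hw, Finset.mem_singleton]
      have hd' : (varsOf F).card + 2 ≤ F.card := by omega
      have hcv := card_varsOf_resolve hF hd' hv
      have hc := card_resolve hF hd' hv
      obtain ⟨hwdc, hout⟩ := ih (hF.resolve hd' hv) (by omega) (by omega)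
      refine ⟨?_, card_outN_le_two_of_resolve hF hd' hv hout⟩
      have hle := card_outN_add_le hF hd' hv
      have hle2 := hout w.compl
      have hvpos := hF.card_outN_pos (x := v) (by simpa [Lit.compl_compl] using compl_mem ha)
      by_cases h1 : (outN F v).card = 1
      · obtain ⟨y, hy⟩ := Finset.card_eq_one.1 h1
        exact isWDC_of_resolve_splitArc hF hd' hv hwdc (y := y) fun b => by
          rw [← mem_outN, hy, Finset.mem_singleton]
      · have hvmem : v ∈ outN F w.compl := mem_outN.2 ((arc_to_iff hv).2 rfl)
        refine isWDC_of_resolve_splitVertex hF hd' hv hwdc fun b => ?_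
        constructor
        · exact fun hb => Finset.card_le_one.1 (by omega) b (mem_outN.2 hb) v hvmem
        · rintro rfl
          exact mem_outN.1 hvmem

theorem stmt6 (k : ℕ) (hk : 2 ≤ k) (F : Finset (Finset Lit)) (hF : MU2 F)
    (hd : deficiency F = (k : ℤ)) (hdeg : ∀ v ∈ varsOf F, 3 ≤ vdeg F v) :
    IsWDC (2 * k) (idg F) ∧ (idg F).Nonlinear := by
  rw [deficiency] at hd
  refine ⟨(hF.isWDC_idg hk (by omega)).1, ?_⟩
  rintro ⟨x, b⟩ hx ⟨h1, h2⟩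
  have h3 := hdeg x (Finset.mem_product.1 hx).1
  rw [inDeg_idg, card_outN hF.2, Lit.compl_compl] at h1
  rw [outDeg_idg, card_outN hF.2] at h2
  cases b <;> simp only [Lit.compl, Bool.not_true, Bool.not_false] at h1 h2 <;>
    rw [vdeg] at h3 <;> omega
end

section
/- If G and G' are nonlinear weak double cycles whose underlying multigraphs are isomorphic, then G and G' are isomorphic as digraphs. -/
/-- `G` is a cyclic sequence of `m` blocks: block `i` has entry vertex `p i` and exit vertex
`q i` (which may coincide, and otherwise are joined by the arc `(p i, q i)`), and there are
arcs from the exit of every block to the entries of the two neighbouring blocks. -/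
structure IsBlockCycle (m : ℕ) (p q : ZMod m → ℕ) (G : FinDigraph ℕ) : Prop where
  three_le : 3 ≤ m
  mem_V : ∀ x, x ∈ G.V ↔ ∃ i, x = p i ∨ x = q i
  p_inj : Function.Injective p
  q_inj : Function.Injective q
  cross : ∀ i j, p i = q j → i = j
  mem_E : ∀ a b, (a, b) ∈ G.E ↔ (∃ i, p i ≠ q i ∧ a = p i ∧ b = q i) ∨
    ∃ i j, (j = i + 1 ∨ i = j + 1) ∧ a = q i ∧ b = p j

/-- `w` is a vertex with a unique in-neighbour and a unique out-neighbour. -/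
def IsLinear (G : FinDigraph ℕ) (w : ℕ) : Prop :=
  w ∈ G.V ∧ (∃ a, ∀ x, (x, w) ∈ G.E ↔ x = a) ∧ ∃ b, ∀ x, (w, x) ∈ G.E ↔ x = b

lemma not_isLinear_of_nonlinear {G : FinDigraph ℕ} (h : G.Nonlinear) (w : ℕ) :
    ¬ IsLinear G w := by
  rintro ⟨hw, ⟨a, ha⟩, b, hb⟩
  refine h w hw ⟨?_, ?_⟩
  · refine Finset.card_eq_one.2 ⟨(a, w), ?_⟩
    ext ⟨x, y⟩
    simp only [Finset.mem_filter, Finset.mem_singleton, Prod.mk.injEq]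
    grind
  · refine Finset.card_eq_one.2 ⟨(w, b), ?_⟩
    ext ⟨x, y⟩
    simp only [Finset.mem_filter, Finset.mem_singleton, Prod.mk.injEq]
    grind

lemma mem_split_arcs (E : Finset (ℕ × ℕ)) (x u v a b : ℕ) :
    (a, b) ∈ insert (u, v) ((E.filter (fun p => p.1 ≠ x ∧ p.2 ≠ x)) ∪
       ((E.filter (fun p => p.2 = x)).image (fun p => (p.1, u))) ∪
       ((E.filter (fun p => p.1 = x)).image (fun p => (v, p.2)))) ↔
    (a = u ∧ b = v) ∨ ((a, b) ∈ E ∧ a ≠ x ∧ b ≠ x) ∨ ((a, x) ∈ E ∧ b = u) ∨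
      (a = v ∧ (x, b) ∈ E) := by
  simp only [Finset.mem_insert, Finset.mem_union, Finset.mem_filter, Finset.mem_image,
    Prod.mk.injEq, Prod.exists]
  grind

lemma ZMod.one_ne_zero_of_three_le {m : ℕ} (h : 3 ≤ m) : (1 : ZMod m) ≠ 0 := by
  intro e
  have : ((1 : ℕ) : ZMod m) = 0 := by exact_mod_cast e
  rw [ZMod.natCast_eq_zero_iff] at this
  exact absurd (Nat.le_of_dvd (by norm_num) this) (by omega)

lemma ZMod.two_ne_zero_of_three_le {m : ℕ} (h : 3 ≤ m) : (2 : ZMod m) ≠ 0 := by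
  intro e
  have : ((2 : ℕ) : ZMod m) = 0 := by exact_mod_cast e
  rw [ZMod.natCast_eq_zero_iff] at this
  exact absurd (Nat.le_of_dvd (by norm_num) this) (by omega)

lemma ZMod.three_ne_zero_of_four_le {m : ℕ} (h : 4 ≤ m) : (3 : ZMod m) ≠ 0 := by
  intro e
  have : ((3 : ℕ) : ZMod m) = 0 := by exact_mod_cast e
  rw [ZMod.natCast_eq_zero_iff] at this
  exact absurd (Nat.le_of_dvd (by norm_num) this) (by omega)

namespace IsBlockCycle

variable {m : ℕ} {p q : ZMod m → ℕ} {G : FinDigraph ℕ}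

lemma p_mem (h : IsBlockCycle m p q G) (i : ZMod m) : p i ∈ G.V := (h.mem_V _).2 ⟨i, .inl rfl⟩

lemma q_mem (h : IsBlockCycle m p q G) (i : ZMod m) : q i ∈ G.V := (h.mem_V _).2 ⟨i, .inr rfl⟩

lemma out_p (h : IsBlockCycle m p q G) {i : ZMod m} (hi : p i ≠ q i) (b : ℕ) :
    (p i, b) ∈ G.E ↔ b = q i := by
  rw [h.mem_E]
  constructor
  · rintro (⟨j, hj, e, rfl⟩ | ⟨j, k, -, e, rfl⟩)
    · rw [h.p_inj e]
    · have := h.cross _ _ e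
      subst this
      exact absurd e hi
  · rintro rfl
    exact .inl ⟨i, hi, rfl, rfl⟩

lemma in_q (h : IsBlockCycle m p q G) {i : ZMod m} (hi : p i ≠ q i) (a : ℕ) :
    (a, q i) ∈ G.E ↔ a = p i := by
  rw [h.mem_E]
  constructor
  · rintro (⟨j, hj, rfl, e⟩ | ⟨k, j, -, rfl, e⟩)
    · rw [h.q_inj e]
    · have := h.cross _ _ e.symm
      subst this
      exact absurd e.symm hi
  · rintro rfl
    exact .inl ⟨i, hi, rfl, rfl⟩

lemma in_p (h : IsBlockCycle m p q G) (i : ZMod m) (a : ℕ) :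
    (a, p i) ∈ G.E ↔ a = q (i + 1) ∨ a = q (i - 1) := by
  rw [h.mem_E]
  constructor
  · rintro (⟨j, hj, rfl, e⟩ | ⟨k, j, hkj, rfl, e⟩)
    · have := h.cross _ _ e
      subst this
      exact absurd e hj
    · have := h.p_inj e
      subst this
      rcases hkj with rfl | rfl
      · right; simp
      · left; rfl
  · rintro (rfl | rfl)
    · exact .inr ⟨i + 1, i, .inr rfl, rfl, rfl⟩
    · exact .inr ⟨i - 1, i, .inl (by ring), rfl, rfl⟩

lemma out_q (h : IsBlockCycle m p q G) (i : ZMod m) (b : ℕ) :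
    (q i, b) ∈ G.E ↔ b = p (i + 1) ∨ b = p (i - 1) := by
  rw [h.mem_E]
  constructor
  · rintro (⟨j, hj, e, rfl⟩ | ⟨j, k, hkj, e, rfl⟩)
    · have := h.cross _ _ e.symm
      subst this
      exact absurd e.symm hj
    · have := h.q_inj e
      subst this
      rcases hkj with rfl | rfl
      · left; rfl
      · right; simp
  · rintro (rfl | rfl)
    · exact .inr ⟨i, i + 1, .inl rfl, rfl, rfl⟩
    · exact .inr ⟨i, i - 1, .inr (by ring), rfl, rfl⟩

/-- Reindexing the blocks by a rotation or a reflection. -/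
lemma reindex (h : IsBlockCycle m p q G) (e : ZMod m ≃ ZMod m)
    (he : (∀ i, e (i + 1) = e i + 1) ∨ ∀ i, e (i + 1) = e i - 1) :
    IsBlockCycle m (p ∘ e) (q ∘ e) G where
  three_le := h.three_le
  mem_V x := by
    rw [h.mem_V]
    exact ⟨fun ⟨i, hi⟩ => ⟨e.symm i, by simpa using hi⟩, fun ⟨i, hi⟩ => ⟨e i, hi⟩⟩
  p_inj := h.p_inj.comp e.injective
  q_inj := h.q_inj.comp e.injective
  cross i j hij := e.injective (h.cross _ _ hij)
  mem_E a b := by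
    rw [h.mem_E]
    have key : ∀ i j, (j = i + 1 ∨ i = j + 1) ↔ (e j = e i + 1 ∨ e i = e j + 1) := by
      intro i j
      rcases he with he | he
      · rw [← he, ← he, e.injective.eq_iff, e.injective.eq_iff]
      · have h1 : j = i + 1 ↔ e i = e j + 1 := by
          rw [← e.injective.eq_iff, he]
          constructor <;> intro h <;> rw [h] <;> ring
        have h2 : i = j + 1 ↔ e j = e i + 1 := by
          rw [← e.injective.eq_iff, he]
          constructor <;> intro h <;> rw [h] <;> ring
        rw [h1, h2, or_comm]
    constructor
    · rintro (⟨i, h1, h2, h3⟩ | ⟨i, j, h1, h2, h3⟩)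
      · exact .inl ⟨e.symm i, by simpa using ⟨h1, h2, h3⟩⟩
      · exact .inr ⟨e.symm i, e.symm j, (key _ _).2 (by simpa using h1), by simpa using h2,
          by simpa using h3⟩
    · rintro (⟨i, h1, h2, h3⟩ | ⟨i, j, h1, h2, h3⟩)
      · exact .inl ⟨e i, h1, h2, h3⟩
      · exact .inr ⟨e i, e j, (key _ _).1 h1, h2, h3⟩

lemma ne_add_one (h : IsBlockCycle m p q G) (i : ZMod m) : i + 1 ≠ i := fun e =>
  ZMod.one_ne_zero_of_three_le h.three_le (by linear_combination e)

lemma ne_sub_one (h : IsBlockCycle m p q G) (i : ZMod m) : i - 1 ≠ i := fun e =>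
  ZMod.one_ne_zero_of_three_le h.three_le (by linear_combination -e)

lemma add_one_ne_sub_one (h : IsBlockCycle m p q G) (i : ZMod m) : i + 1 ≠ i - 1 := fun e =>
  ZMod.two_ne_zero_of_three_le h.three_le (by linear_combination e)

lemma wellFormed (h : IsBlockCycle m p q G) : G.WellFormed := by
  rintro ⟨a, b⟩ hab
  rcases (h.mem_E a b).1 hab with ⟨i, hi, rfl, rfl⟩ | ⟨i, j, hij, rfl, rfl⟩
  · exact ⟨h.p_mem i, h.q_mem i, hi⟩
  · refine ⟨h.q_mem i, h.p_mem j, fun e => ?_⟩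
    have := h.cross _ _ e.symm
    subst this
    rcases hij with e | e <;> exact h.ne_add_one _ e.symm

/-- Splitting a one-vertex block. -/
lemma splitVertex (h : IsBlockCycle m p q G) {G' : FinDigraph ℕ} {i : ZMod m} {u v : ℕ}
    (hi : p i = q i) (hu : u ∉ G.V) (hv : v ∉ G.V) (huv : u ≠ v)
    (hV : G'.V = insert u (insert v (G.V.erase (p i))))
    (hE : ∀ a b, (a, b) ∈ G'.E ↔ (a = u ∧ b = v) ∨ ((a, b) ∈ G.E ∧ a ≠ p i ∧ b ≠ p i) ∨
      ((a, p i) ∈ G.E ∧ b = u) ∨ (a = v ∧ (p i, b) ∈ G.E)) :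
    IsBlockCycle m (Function.update p i u) (Function.update q i v) G' := by
  have hpu : ∀ j, p j ≠ u := fun j e => hu (e ▸ h.p_mem j)
  have hqu : ∀ j, q j ≠ u := fun j e => hu (e ▸ h.q_mem j)
  have hpv : ∀ j, p j ≠ v := fun j e => hv (e ▸ h.p_mem j)
  have hqv : ∀ j, q j ≠ v := fun j e => hv (e ▸ h.q_mem j)
  have hp1 := h.p_inj
  have hq1 := h.q_inj
  have hc := h.cross
  refine ⟨h.three_le, fun x => ?_, fun j k e => ?_, fun j k e => ?_, fun j k e => ?_,
    fun a b => ?_⟩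
  · rw [hV, Finset.mem_insert, Finset.mem_insert, Finset.mem_erase, h.mem_V]
    constructor
    · rintro (rfl | rfl | ⟨hx, j, hj⟩)
      · exact ⟨i, by simp⟩
      · exact ⟨i, by simp⟩
      · have : j ≠ i := by grind
        exact ⟨j, by simpa [this] using hj⟩
    · rintro ⟨j, hj⟩
      by_cases hji : j = i
      · subst hji
        simp at hj
        tauto
      · simp [hji] at hj
        refine .inr (.inr ⟨?_, j, hj⟩)
        rcases hj with rfl | rfl
        · exact fun e => hji (hp1 e)
        · exact fun e => hji (hc _ _ e.symm).symm
  · simp only [Function.update_apply] at e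
    grind [Function.Injective]
  · simp only [Function.update_apply] at e
    grind [Function.Injective]
  · simp only [Function.update_apply] at e
    grind
  · rw [hE]
    have hout : ∀ b, (p i, b) ∈ G.E ↔ b = p (i + 1) ∨ b = p (i - 1) := by
      intro b; rw [hi]; exact h.out_q i b
    rw [h.in_p, hout]
    have n1 := h.ne_add_one i
    have n2 := h.ne_sub_one i
    constructor
    · rintro (⟨rfl, rfl⟩ | ⟨hab, ha, hb⟩ | ⟨rfl | rfl, rfl⟩ | ⟨rfl, rfl | rfl⟩)
      · exact .inl ⟨i, by simpa using huv⟩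
      · rcases (h.mem_E a b).1 hab with ⟨j, h1, h2, h3⟩ | ⟨j, k, h1, h2, h3⟩
        · have : j ≠ i := by grind
          exact .inl ⟨j, by simp [this, h1, h2, h3]⟩
        · have hj : j ≠ i := by grind
          have hk : k ≠ i := by grind
          exact .inr ⟨j, k, h1, by simp [hj, hk, h2, h3]⟩
      · exact .inr ⟨i + 1, i, .inr rfl, by simp [n1]⟩
      · exact .inr ⟨i - 1, i, .inl (by ring), by simp [n2]⟩
      · exact .inr ⟨i, i + 1, .inl rfl, by simp [n1]⟩
      · exact .inr ⟨i, i - 1, .inr (by ring), by simp [n2]⟩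
    · rintro (⟨j, h1, h2, h3⟩ | ⟨j, k, h1, h2, h3⟩)
      · by_cases hj : j = i
        · subst hj
          simp at h2 h3
          exact .inl ⟨h2, h3⟩
        · simp [hj] at h1 h2 h3
          refine .inr (.inl ⟨(h.mem_E a b).2 (.inl ⟨j, h1, h2, h3⟩), ?_, ?_⟩)
          · rw [h2]; exact fun e => hj (hp1 e)
          · rw [h3]; exact fun e => hj (hc _ _ e.symm).symm
      · by_cases hj : j = i
        · subst hj
          have hk : k ≠ j := by
            rintro rfl
            rcases h1 with h1 | h1 <;> exact n1 h1.symm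
          simp [hk] at h2 h3
          refine .inr (.inr (.inr ⟨h2, ?_⟩))
          rcases h1 with rfl | rfl
          · exact .inl h3
          · right; simpa using h3
        · by_cases hk : k = i
          · subst hk
            simp [hj] at h2 h3
            refine .inr (.inr (.inl ⟨?_, h3⟩))
            rcases h1 with rfl | rfl
            · right; simpa using h2
            · exact .inl h2
          · simp [hj, hk] at h2 h3
            refine .inr (.inl ⟨(h.mem_E a b).2 (.inr ⟨j, k, h1, h2, h3⟩), ?_, ?_⟩)
            · rw [h2]; exact fun e => hj (hc _ _ e.symm).symm
            · rw [h3]; exact fun e => hk (hp1 e)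

end IsBlockCycle

lemma splitVertex_wellFormed {G G' : FinDigraph ℕ} (hG : G.WellFormed) (h : SplitVertex G G') :
    G'.WellFormed := by
  obtain ⟨x, u, v, hx, hu, hv, huv, hV, hE⟩ := h
  rintro ⟨a, b⟩ hab
  rw [hE, mem_split_arcs] at hab
  rw [hV]
  simp only [Finset.mem_insert, Finset.mem_erase]
  have h1 := hG (a, b)
  have h2 := hG (a, x)
  have h3 := hG (x, b)
  clear hE hV
  grind

lemma splitArc_wellFormed {G G' : FinDigraph ℕ} (hG : G.WellFormed) (h : SplitArc G G') :
    G'.WellFormed := by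
  obtain ⟨x, y, v, hxy, hv, hV, hE⟩ := h
  rintro ⟨a, b⟩ hab
  rw [hE] at hab
  rw [hV]
  simp only [Finset.mem_insert, Finset.mem_erase, Prod.mk.injEq] at hab ⊢
  have h1 := hG (a, b)
  have h2 := hG (x, y)
  clear hE hV
  grind

lemma splitArc_exists_isLinear {G G' : FinDigraph ℕ} (hG : G.WellFormed) (h : SplitArc G G') :
    ∃ w, IsLinear G' w := by
  obtain ⟨x, y, v, hxy, hv, hV, hE⟩ := h
  have h1 : ∀ a, (a, v) ∉ G.E := fun a ha => hv (hG _ ha).2.1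
  have h2 : ∀ a, (v, a) ∉ G.E := fun a ha => hv (hG _ ha).1
  have hx : x ∈ G.V := (hG _ hxy).1
  have hy : y ∈ G.V := (hG _ hxy).2.1
  refine ⟨v, by simp [hV], ⟨x, fun a => ?_⟩, y, fun a => ?_⟩ <;> rw [hE] <;>
    simp only [Finset.mem_insert, Finset.mem_erase, Prod.mk.injEq] <;> grind

/-- Splitting a vertex with a unique in-neighbour or a unique out-neighbour creates a linear
vertex. -/
lemma exists_isLinear_of_split {G G' : FinDigraph ℕ} (hG : G.WellFormed) {x u v : ℕ}
    (hu : u ∉ G.V) (hv : v ∉ G.V) (huv : u ≠ v)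
    (hV : G'.V = insert u (insert v (G.V.erase x)))
    (hE : ∀ a b, (a, b) ∈ G'.E ↔ (a = u ∧ b = v) ∨ ((a, b) ∈ G.E ∧ a ≠ x ∧ b ≠ x) ∨
      ((a, x) ∈ G.E ∧ b = u) ∨ (a = v ∧ (x, b) ∈ G.E))
    (h : (∃ c, ∀ a, (a, x) ∈ G.E ↔ a = c) ∨ ∃ c, ∀ a, (x, a) ∈ G.E ↔ a = c) :
    ∃ w, IsLinear G' w := by
  have h1 : ∀ a, (a, v) ∉ G.E := fun a ha => hv (hG _ ha).2.1
  have h2 : ∀ a, (v, a) ∉ G.E := fun a ha => hv (hG _ ha).1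
  have h3 : ∀ a, (a, u) ∉ G.E := fun a ha => hu (hG _ ha).2.1
  have h4 : ∀ a, (u, a) ∉ G.E := fun a ha => hu (hG _ ha).1
  rcases h with ⟨c, hc⟩ | ⟨c, hc⟩
  · refine ⟨u, by simp [hV], ⟨c, fun a => ?_⟩, v, fun a => ?_⟩ <;> rw [hE] <;> grind
  · refine ⟨v, by simp [hV], ⟨u, fun a => ?_⟩, c, fun a => ?_⟩ <;> rw [hE] <;> grind

lemma splitVertex_exists_isLinear {G G' : FinDigraph ℕ} (hG : G.WellFormed)
    (h : SplitVertex G G') (hw : ∃ w, IsLinear G w) : ∃ w, IsLinear G' w := by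
  obtain ⟨x, u, v, hx, hu, hv, huv, hV, hE⟩ := h
  obtain ⟨w, hwV, ⟨c, hc⟩, d, hd⟩ := hw
  have hE' : ∀ a b, (a, b) ∈ G'.E ↔ _ := fun a b => by rw [hE, mem_split_arcs]
  by_cases hwx : w = x
  · subst hwx
    exact exists_isLinear_of_split hG hu hv huv hV hE' (.inl ⟨c, hc⟩)
  · have hwu : w ≠ u := fun e => hu (e ▸ hwV)
    have hwv : w ≠ v := fun e => hv (e ▸ hwV)
    clear hE
    refine ⟨w, by simp [hV, hwx, hwV], ⟨if c = x then v else c, fun a => ?_⟩,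
      if d = x then u else d, fun a => ?_⟩
    · rw [hE']
      have := hc a
      have := hc x
      grind
    · rw [hE']
      have := hd a
      have := hd x
      grind

lemma isBlockCycle_of_isDoubleCycle {m : ℕ} {G : FinDigraph ℕ} (h : IsDoubleCycle m G) :
    ∃ p : ZMod m → ℕ, IsBlockCycle m p p G := by
  obtain ⟨hm, f, ⟨hmaps, hinj, hsurj⟩, hE⟩ := h
  have : NeZero m := ⟨by omega⟩
  have : Fact (1 < m) := ⟨by omega⟩
  have hmem : ∀ i : ZMod m, i.val ∈ ((stdDoubleCycle m).V : Set ℕ) := fun i => by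
    simpa [stdDoubleCycle] using ZMod.val_lt i
  have hsucc : ∀ i : ZMod m, (i + 1).val = (i.val + 1) % m := fun i => by
    rw [ZMod.val_add, ZMod.val_one]
  have hp : Function.Injective fun i : ZMod m => f i.val := fun i j e =>
    ZMod.val_injective m (hinj (hmem i) (hmem j) e)
  refine ⟨fun i => f i.val, hm, fun x => ?_, hp, hp, fun i j e => hp e, fun a b => ?_⟩
  · simp only [or_self]
    constructor
    · intro hx
      obtain ⟨k, hk, rfl⟩ := hsurj hx
      have hk : k < m := by simpa [stdDoubleCycle] using hk
      exact ⟨(k : ZMod m), by rw [ZMod.val_natCast_of_lt hk]⟩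
    · rintro ⟨i, rfl⟩
      exact hmaps (hmem i)
  · rw [← hE]
    simp only [stdDoubleCycle, Finset.mem_image, Finset.mem_biUnion, Finset.mem_range,
      Finset.mem_insert, Finset.mem_singleton, Prod.mk.injEq, ne_eq, not_true_eq_false,
      false_and, exists_false, false_or]
    constructor
    · rintro ⟨_, ⟨k, hk, rfl | rfl⟩, rfl, rfl⟩
      · exact ⟨k, k + 1, .inl rfl, by rw [ZMod.val_natCast_of_lt hk],
          by rw [hsucc, ZMod.val_natCast_of_lt hk]⟩
      · exact ⟨k + 1, k, .inr rfl, by rw [hsucc, ZMod.val_natCast_of_lt hk],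
          by rw [ZMod.val_natCast_of_lt hk]⟩
    · rintro ⟨i, j, rfl | rfl, rfl, rfl⟩
      · exact ⟨_, ⟨i.val, ZMod.val_lt i, .inl rfl⟩, rfl, by rw [hsucc]⟩
      · exact ⟨_, ⟨j.val, ZMod.val_lt j, .inr rfl⟩, by rw [hsucc], rfl⟩

/-- A nonlinear weak double cycle arises from a double cycle by splitting some of the vertices
of the latter, each one at most once. -/
lemma IsWDC.exists_isBlockCycle {m : ℕ} {G : FinDigraph ℕ} (h : IsWDC m G)
    (hlin : G.Nonlinear) : ∃ p q : ZMod m → ℕ, IsBlockCycle m p q G := by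
  obtain ⟨G₀, h₀, hsplit⟩ := h
  suffices H : (∃ p q : ZMod m → ℕ, IsBlockCycle m p q G) ∨
      (G.WellFormed ∧ ∃ w, IsLinear G w) by
    rcases H with H | ⟨-, w, hw⟩
    · exact H
    · exact absurd hw (not_isLinear_of_nonlinear hlin w)
  clear hlin
  induction hsplit with
  | refl =>
    obtain ⟨p, hp⟩ := isBlockCycle_of_isDoubleCycle h₀
    exact .inl ⟨p, p, hp⟩
  | @tail A B _ hAB ih =>
    have hA : A.WellFormed := by
      rcases ih with ⟨p, q, h⟩ | h
      · exact h.wellFormed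
      · exact h.1
    rcases hAB with hAB | hAB
    · rcases ih with ⟨p, q, h⟩ | h
      · have hB := splitVertex_wellFormed hA hAB
        obtain ⟨x, u, v, hx, hu, hv, huv, hV, hE⟩ := hAB
        have hE' : ∀ a b, (a, b) ∈ B.E ↔ _ := fun a b => by rw [hE, mem_split_arcs]
        obtain ⟨i, hi⟩ := (h.mem_V x).1 hx
        by_cases hpq : p i = q i
        · have hxi : x = p i := by rcases hi with hi | hi <;> simp [hi, hpq]
          subst hxi
          exact .inl ⟨_, _, h.splitVertex hpq hu hv huv hV hE'⟩
        · refine .inr ⟨hB, exists_isLinear_of_split hA hu hv huv hV hE' ?_⟩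
          rcases hi with rfl | rfl
          · exact .inr ⟨_, h.out_p hpq⟩
          · exact .inl ⟨_, h.in_q hpq⟩
      · exact .inr ⟨splitVertex_wellFormed hA hAB, splitVertex_exists_isLinear hA hAB h.2⟩
    · exact .inr ⟨splitArc_wellFormed hA hAB, splitArc_exists_isLinear hA hAB⟩

namespace IsBlockCycle

variable {m : ℕ} {p q p' q' : ZMod m → ℕ} {G G' : FinDigraph ℕ}

/-- Block cycles with the same pattern of one-vertex blocks are isomorphic. -/
lemma exists_digraphIso (h : IsBlockCycle m p q G) (h' : IsBlockCycle m p' q' G')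
    (hpq : ∀ i, p i = q i ↔ p' i = q' i) : ∃ g : ℕ → ℕ, DigraphIso G G' g := by
  classical
  let g : ℕ → ℕ := fun x => if hx : ∃ i, x = p i then p' hx.choose else
    if hx : ∃ i, x = q i then q' hx.choose else 0
  have gp : ∀ i, g (p i) = p' i := fun i => by
    have hx : ∃ j, p i = p j := ⟨i, rfl⟩
    simp only [g, dif_pos hx]
    rw [h.p_inj hx.choose_spec.symm]
  have gq : ∀ i, g (q i) = q' i := fun i => by
    by_cases hi : p i = q i
    · rw [← hi, gp, (hpq i).1 hi]
    · have hx : ∃ j, q i = q j := ⟨i, rfl⟩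
      have hx' : ¬ ∃ j, q i = p j := by
        rintro ⟨j, hj⟩
        have := h.cross _ _ hj.symm
        subst this
        exact hi hj.symm
      simp only [g, dif_neg hx', dif_pos hx]
      rw [h.q_inj hx.choose_spec.symm]
  refine ⟨g, ⟨fun x hx => ?_, fun x hx y hy hxy => ?_, fun y hy => ?_⟩, ?_⟩
  · obtain ⟨i, rfl | rfl⟩ := (h.mem_V x).1 hx
    · rw [gp]; exact h'.p_mem i
    · rw [gq]; exact h'.q_mem i
  · obtain ⟨i, rfl | rfl⟩ := (h.mem_V x).1 hx <;> obtain ⟨j, rfl | rfl⟩ := (h.mem_V y).1 hy <;>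
      simp only [gp, gq] at hxy
    · rw [h'.p_inj hxy]
    · have := h'.cross _ _ hxy
      subst this
      exact (hpq _).2 hxy
    · have := h'.cross _ _ hxy.symm
      subst this
      exact ((hpq _).2 hxy.symm).symm
    · rw [h'.q_inj hxy]
  · obtain ⟨i, rfl | rfl⟩ := (h'.mem_V y).1 hy
    · exact ⟨p i, h.p_mem i, gp i⟩
    · exact ⟨q i, h.q_mem i, gq i⟩
  · ext ⟨a, b⟩
    rw [h'.mem_E]
    simp only [Finset.mem_image, Prod.exists, Prod.mk.injEq]
    constructor
    · rintro ⟨c, d, hcd, rfl, rfl⟩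
      rcases (h.mem_E c d).1 hcd with ⟨i, hi, rfl, rfl⟩ | ⟨i, j, hij, rfl, rfl⟩
      · exact .inl ⟨i, mt (hpq i).2 hi, gp i, gq i⟩
      · exact .inr ⟨i, j, hij, gq i, gp j⟩
    · rintro (⟨i, hi, rfl, rfl⟩ | ⟨i, j, hij, rfl, rfl⟩)
      · exact ⟨p i, q i, (h.mem_E _ _).2 (.inl ⟨i, mt (hpq i).1 hi, rfl, rfl⟩), gp i, gq i⟩
      · exact ⟨q i, p j, (h.mem_E _ _).2 (.inr ⟨i, j, hij, rfl, rfl⟩), gq i, gp j⟩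

end IsBlockCycle

/-- The degree of a vertex in the underlying multigraph. -/
def multDegree (G : FinDigraph ℕ) (x : ℕ) : ℕ := ∑ y ∈ G.V, mult G x y

lemma multDegree_eq_card_add_card (G : FinDigraph ℕ) (x : ℕ) :
    multDegree G x = (G.V.filter fun y => (x, y) ∈ G.E).card +
      (G.V.filter fun y => (y, x) ∈ G.E).card := by
  simp only [multDegree, mult, Finset.sum_add_distrib, Finset.card_filter]

lemma MultigraphIso.multDegree_eq {G G' : FinDigraph ℕ} {f : ℕ → ℕ} (hf : MultigraphIso G G' f)
    {x : ℕ} (hx : x ∈ G.V) : multDegree G' (f x) = multDegree G x :=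
  (Finset.sum_nbij f (fun _ hy => hf.1.mapsTo hy) hf.1.injOn hf.1.surjOn
    fun y hy => hf.2 x hx y hy).symm

/-- Adjacency in the underlying multigraph. -/
def ArcJoined (G : FinDigraph ℕ) (x y : ℕ) : Prop := (x, y) ∈ G.E ∨ (y, x) ∈ G.E

lemma MultigraphIso.joined_iff {G G' : FinDigraph ℕ} {f : ℕ → ℕ} (hf : MultigraphIso G G' f)
    {x y : ℕ} (hx : x ∈ G.V) (hy : y ∈ G.V) : ArcJoined G' (f x) (f y) ↔ ArcJoined G x y := by
  have key : ∀ (H : FinDigraph ℕ) (a b : ℕ), ArcJoined H a b ↔ mult H a b ≠ 0 := by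
    intro H a b
    simp only [ArcJoined, mult]
    split_ifs <;> simp [*]
  rw [key, key, hf.2 x hx y hy]

lemma card_filter_eq_one {V : Finset ℕ} {P : ℕ → Prop} [DecidablePred P] {a : ℕ} (ha : a ∈ V)
    (h : ∀ x, P x ↔ x = a) : (V.filter P).card = 1 := by
  refine Finset.card_eq_one.2 ⟨a, ?_⟩
  ext x
  simp only [Finset.mem_filter, h, Finset.mem_singleton]
  grind

lemma card_filter_eq_two {V : Finset ℕ} {P : ℕ → Prop} [DecidablePred P] {a b : ℕ} (ha : a ∈ V)
    (hb : b ∈ V) (hab : a ≠ b) (h : ∀ x, P x ↔ x = a ∨ x = b) : (V.filter P).card = 2 := by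
  refine Finset.card_eq_two.2 ⟨a, b, hab, ?_⟩
  ext x
  simp only [Finset.mem_filter, h, Finset.mem_singleton, Finset.mem_insert]
  grind

namespace IsBlockCycle

section

variable {m : ℕ} {p q : ZMod m → ℕ} {G : FinDigraph ℕ}

lemma card_in_p (h : IsBlockCycle m p q G) (i : ZMod m) :
    (G.V.filter fun y => (y, p i) ∈ G.E).card = 2 :=
  card_filter_eq_two (h.q_mem _) (h.q_mem _)
    (fun e => h.add_one_ne_sub_one i (h.q_inj e)) (h.in_p i)

lemma card_out_q (h : IsBlockCycle m p q G) (i : ZMod m) :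
    (G.V.filter fun y => (q i, y) ∈ G.E).card = 2 :=
  card_filter_eq_two (h.p_mem _) (h.p_mem _)
    (fun e => h.add_one_ne_sub_one i (h.p_inj e)) (h.out_q i)

lemma multDegree_eq_four_iff (h : IsBlockCycle m p q G) {i : ZMod m} {x : ℕ}
    (hx : x = p i ∨ x = q i) : multDegree G x = 4 ↔ p i = q i := by
  rw [multDegree_eq_card_add_card]
  by_cases hi : p i = q i
  · have hx : x = p i := by rcases hx with hx | hx <;> simp [hx, hi]
    have := h.card_out_q i
    rw [← hi] at this
    rw [hx, this, h.card_in_p]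
    simp [hi]
  · have h1 := card_filter_eq_one (h.q_mem i) (h.out_p hi)
    have h2 := card_filter_eq_one (h.p_mem i) (h.in_q hi)
    have h3 := h.card_in_p i
    have h4 := h.card_out_q i
    rcases hx with rfl | rfl
    · simp [h1, h3, hi]
    · simp [h2, h4, hi]

/-- The number of one-vertex blocks is the number of vertices of degree four. -/
lemma card_filter_multDegree (h : IsBlockCycle m p q G) [NeZero m] :
    (G.V.filter fun x => multDegree G x = 4).card =
      (Finset.univ.filter fun i => p i = q i).card := by
  rw [← Finset.card_image_of_injective _ h.p_inj]
  congr 1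
  ext x
  simp only [Finset.mem_filter, Finset.mem_image, Finset.mem_univ, true_and]
  constructor
  · rintro ⟨hx, hd⟩
    obtain ⟨i, hi⟩ := (h.mem_V x).1 hx
    have := (h.multDegree_eq_four_iff hi).1 hd
    refine ⟨i, this, ?_⟩
    rcases hi with hi | hi <;> simp [hi, this]
  · rintro ⟨i, hi, rfl⟩
    exact ⟨h.p_mem i, (h.multDegree_eq_four_iff (.inl rfl)).2 hi⟩

lemma card_V_add (h : IsBlockCycle m p q G) [NeZero m] :
    G.V.card + (Finset.univ.filter fun i => p i = q i).card = 2 * m := by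
  have hV : G.V = Finset.univ.image p ∪ Finset.univ.image q := by
    ext x
    simp only [h.mem_V, Finset.mem_union, Finset.mem_image, Finset.mem_univ, true_and]
    grind
  have hI : Finset.univ.image p ∩ Finset.univ.image q =
      (Finset.univ.filter fun i => p i = q i).image p := by
    ext x
    simp only [Finset.mem_inter, Finset.mem_image, Finset.mem_univ, true_and,
      Finset.mem_filter]
    constructor
    · rintro ⟨⟨i, rfl⟩, j, hj⟩
      have := h.cross _ _ hj.symm
      subst this
      exact ⟨i, hj.symm, rfl⟩
    · rintro ⟨i, hi, rfl⟩
      exact ⟨⟨i, rfl⟩, i, hi.symm⟩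
  rw [hV, ← Finset.card_image_of_injective _ h.p_inj, ← hI, Finset.card_union_add_card_inter,
    Finset.card_image_of_injective _ h.p_inj, Finset.card_image_of_injective _ h.q_inj,
    Finset.card_univ, ZMod.card]
  ring

lemma block_unique (h : IsBlockCycle m p q G) {i j : ZMod m} {x : ℕ} (hi : x = p i ∨ x = q i)
    (hj : x = p j ∨ x = q j) : i = j := by
  rcases hi with rfl | rfl <;> rcases hj with hj | hj
  · exact h.p_inj hj
  · exact h.cross _ _ hj
  · exact (h.cross _ _ hj.symm).symm
  · exact h.q_inj hj

lemma block_of_joined (h : IsBlockCycle m p q G) {i j : ZMod m} {x y : ℕ}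
    (hx : x = p i ∨ x = q i) (hy : y = p j ∨ y = q j) (hxy : ArcJoined G x y) :
    j = i ∨ j = i + 1 ∨ i = j + 1 := by
  have key : ∀ (k l : ZMod m) (a b : ℕ), (a = p k ∨ a = q k) → (b = p l ∨ b = q l) →
      (a, b) ∈ G.E → l = k ∨ l = k + 1 ∨ k = l + 1 := by
    intro k l a b ha hb hab
    rcases (h.mem_E a b).1 hab with ⟨i, -, h1, h2⟩ | ⟨i, j, hij, h1, h2⟩
    · have e1 := h.block_unique ha (.inl h1)
      have e2 := h.block_unique hb (.inr h2)
      subst e1 e2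
      exact .inl rfl
    · have e1 := h.block_unique ha (.inr h1)
      have e2 := h.block_unique hb (.inl h2)
      subst e1 e2
      exact .inr hij
  rcases hxy with hxy | hxy
  · exact key _ _ _ _ hx hy hxy
  · have := key _ _ _ _ hy hx hxy
    grind

lemma exists_joined (h : IsBlockCycle m p q G) (i : ZMod m) {y : ℕ}
    (hy : y = p (i + 1) ∨ y = q (i + 1)) : ∃ x, (x = p i ∨ x = q i) ∧ ArcJoined G x y := by
  rcases hy with rfl | rfl
  · exact ⟨q i, .inr rfl, .inl ((h.mem_E _ _).2 (.inr ⟨i, i + 1, .inl rfl, rfl, rfl⟩))⟩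
  · exact ⟨p i, .inl rfl, .inr ((h.mem_E _ _).2 (.inr ⟨i + 1, i, .inr rfl, rfl, rfl⟩))⟩

/-- A block is determined by the two blocks before it. -/
lemma mem_block_add_two (h : IsBlockCycle m p q G) (i : ZMod m) (y : ℕ) :
    (y = p (i + 1 + 1) ∨ y = q (i + 1 + 1)) ↔
      y ∈ G.V ∧ (∃ x, (x = p (i + 1) ∨ x = q (i + 1)) ∧ ArcJoined G x y) ∧
        ¬ (y = p (i + 1) ∨ y = q (i + 1)) ∧ ¬ (y = p i ∨ y = q i) := by
  constructor
  · intro hy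
    refine ⟨(h.mem_V y).2 ⟨_, hy⟩, h.exists_joined _ hy, fun hy' => ?_, fun hy' => ?_⟩
    · exact h.ne_add_one _ (h.block_unique hy hy')
    · exact ZMod.two_ne_zero_of_three_le h.three_le
        (by linear_combination h.block_unique hy hy')
  · rintro ⟨hV, ⟨x, hx, hxy⟩, h1, h2⟩
    obtain ⟨j, hj⟩ := (h.mem_V y).1 hV
    rcases h.block_of_joined hx hj hxy with rfl | rfl | e
    · exact absurd hj h1
    · exact hj
    · rw [← add_right_cancel e] at hj
      exact absurd hj h2

end

variable {m : ℕ} {p q p' q' : ZMod m → ℕ} {G G' : FinDigraph ℕ} {f : ℕ → ℕ}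

/-- A multigraph isomorphism which respects two consecutive blocks respects all of them. -/
lemma mem_block_iff (h : IsBlockCycle m p q G) (h' : IsBlockCycle m p' q' G')
    (hf : MultigraphIso G G' f)
    (h0 : ∀ x ∈ G.V, (f x = p' 0 ∨ f x = q' 0) ↔ (x = p 0 ∨ x = q 0))
    (h1 : ∀ x ∈ G.V, (f x = p' 1 ∨ f x = q' 1) ↔ (x = p 1 ∨ x = q 1)) (i : ZMod m) :
    ∀ x ∈ G.V, (f x = p' i ∨ f x = q' i) ↔ (x = p i ∨ x = q i) := by
  have key : ∀ n : ℕ, (∀ x ∈ G.V, (f x = p' n ∨ f x = q' n) ↔ (x = p n ∨ x = q n)) ∧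
      ∀ x ∈ G.V, (f x = p' (n + 1) ∨ f x = q' (n + 1)) ↔ (x = p (n + 1) ∨ x = q (n + 1)) := by
    intro n
    induction n with
    | zero => simpa using ⟨h0, h1⟩
    | succ n ih =>
      push_cast
      refine ⟨ih.2, fun y hy => ?_⟩
      rw [h.mem_block_add_two, h'.mem_block_add_two, ih.1 y hy, ih.2 y hy]
      have e1 : f y ∈ G'.V ↔ y ∈ G.V := ⟨fun _ => hy, fun hy => hf.1.mapsTo hy⟩
      rw [e1]
      refine and_congr_right fun _ => and_congr_left fun _ => ⟨?_, ?_⟩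
      · rintro ⟨x', hx', hj⟩
        obtain ⟨x, hx, rfl⟩ := hf.1.surjOn ((h'.mem_V x').2 ⟨_, hx'⟩)
        exact ⟨x, (ih.2 x hx).1 hx', (hf.joined_iff hx hy).1 hj⟩
      · rintro ⟨x, hx, hj⟩
        have hxV := (h.mem_V x).2 ⟨_, hx⟩
        exact ⟨f x, (ih.2 x hxV).2 hx, (hf.joined_iff hxV hy).2 hj⟩
  have : NeZero m := ⟨by have := h.three_le; omega⟩
  simpa using (key i.val).1

lemma eq_iff_eq_of_mem_block_iff (h : IsBlockCycle m p q G) (h' : IsBlockCycle m p' q' G')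
    (hf : MultigraphIso G G' f) {i j : ZMod m}
    (hb : ∀ x ∈ G.V, (f x = p' j ∨ f x = q' j) ↔ (x = p i ∨ x = q i)) :
    p i = q i ↔ p' j = q' j := by
  rw [← h.multDegree_eq_four_iff (.inl rfl), ← hf.multDegree_eq (h.p_mem i),
    h'.multDegree_eq_four_iff ((hb _ (h.p_mem i)).2 (.inl rfl))]

/-- With at least four blocks, a multigraph isomorphism respects a one-vertex block followed by a
two-vertex block. -/
lemma exists_consecutive_blocks (h : IsBlockCycle m p q G) (h' : IsBlockCycle m p' q' G')
    (hf : MultigraphIso G G' f) (hm : 4 ≤ m) {i : ZMod m} (hi : p i = q i)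
    (hi' : p (i + 1) ≠ q (i + 1)) :
    ∃ j k : ZMod m, (k = j + 1 ∨ j = k + 1) ∧
      (∀ x ∈ G.V, (f x = p' j ∨ f x = q' j) ↔ (x = p i ∨ x = q i)) ∧
      ∀ x ∈ G.V, (f x = p' k ∨ f x = q' k) ↔ (x = p (i + 1) ∨ x = q (i + 1)) := by
  have hpV := h.p_mem i
  have huV := h.p_mem (i + 1)
  have hvV := h.q_mem (i + 1)
  have inj : ∀ x ∈ G.V, ∀ y ∈ G.V, f x = f y → x = y := fun x hx y hy e => hf.1.injOn hx hy e
  obtain ⟨j, hj⟩ := (h'.mem_V (f (p i))).1 (hf.1.mapsTo hpV)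
  obtain ⟨k, hk⟩ := (h'.mem_V (f (p (i + 1)))).1 (hf.1.mapsTo huV)
  obtain ⟨l, hl⟩ := (h'.mem_V (f (q (i + 1)))).1 (hf.1.mapsTo hvV)
  have hjq : p' j = q' j := by
    rw [← h'.multDegree_eq_four_iff hj, hf.multDegree_eq hpV]
    exact (h.multDegree_eq_four_iff (.inl rfl)).2 hi
  have hxu : ArcJoined G (p i) (p (i + 1)) :=
    .inl ((h.mem_E _ _).2 (.inr ⟨i, i + 1, .inl rfl, hi, rfl⟩))
  have hxv : ArcJoined G (p i) (q (i + 1)) :=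
    .inr ((h.mem_E _ _).2 (.inr ⟨i + 1, i, .inr rfl, rfl, rfl⟩))
  have huv : ArcJoined G (p (i + 1)) (q (i + 1)) :=
    .inl ((h.mem_E _ _).2 (.inl ⟨i + 1, hi', rfl, rfl⟩))
  have n1 := h.ne_add_one i
  have hkj : k ≠ j := by
    rintro rfl
    have := inj _ hpV _ huV (by grind)
    exact n1 (h.p_inj this).symm
  have hlj : l ≠ j := by
    rintro rfl
    have := inj _ hpV _ hvV (by grind)
    exact n1 (h.cross _ _ this).symm
  have hk1 := (h'.block_of_joined hj hk ((hf.joined_iff hpV huV).2 hxu)).resolve_left hkj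
  have hl1 := (h'.block_of_joined hj hl ((hf.joined_iff hpV hvV).2 hxv)).resolve_left hlj
  have hkl := h'.block_of_joined hk hl ((hf.joined_iff huV hvV).2 huv)
  have one := ZMod.one_ne_zero_of_three_le h.three_le
  have three := ZMod.three_ne_zero_of_four_le hm
  have hlk : l = k := by
    rcases hkl with e | e | e
    · exact e
    · rcases hk1 with e1 | e1 <;> rcases hl1 with e2 | e2
      · exact absurd (by linear_combination e2 - e - e1) one
      · exact absurd (by linear_combination -e - e1 - e2) three
      · exact absurd (by linear_combination e - e1 - e2) one
      · exact absurd (by linear_combination e1 - e2 - e) one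
    · rcases hk1 with e1 | e1 <;> rcases hl1 with e2 | e2
      · exact absurd (by linear_combination e1 - e2 - e) one
      · exact absurd (by linear_combination e - e1 - e2) one
      · exact absurd (by linear_combination -e - e1 - e2) three
      · exact absurd (by linear_combination e2 - e1 - e) one
  subst hlk
  refine ⟨j, l, hk1, fun x hx => ⟨fun hfx => ?_, fun hx => ?_⟩, fun x hx => ⟨fun hfx => ?_, ?_⟩⟩
  · left
    exact inj x hx _ hpV (by grind)
  · have : x = p i := by grind
    rw [this]
    exact hj
  · have hne : f (p (i + 1)) ≠ f (q (i + 1)) := fun e => hi' (inj _ huV _ hvV e)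
    have : f x = f (p (i + 1)) ∨ f x = f (q (i + 1)) := by grind
    exact this.imp (inj x hx _ huV) (inj x hx _ hvV)
  · rintro (rfl | rfl)
    · exact hk
    · exact hl

end IsBlockCycle

lemma exists_rotation_of_card_eq_three (U U' : Finset (ZMod 3)) (h : U.card = U'.card) :
    ∃ r, ∀ i, i ∈ U ↔ i + r ∈ U' := by
  revert U U'
  decide

namespace IsBlockCycle

variable {m : ℕ} {p q p' q' : ZMod m → ℕ} {G G' : FinDigraph ℕ} {f : ℕ → ℕ}

lemma exists_digraphIso_of_mixed (h : IsBlockCycle m p q G) (h' : IsBlockCycle m p' q' G')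
    (hf : MultigraphIso G G' f) (hm : 4 ≤ m) {i : ZMod m} (hi : p i = q i)
    (hi' : p (i + 1) ≠ q (i + 1)) : ∃ g : ℕ → ℕ, DigraphIso G G' g := by
  obtain ⟨j, k, hjk, hj, hk⟩ := h.exists_consecutive_blocks h' hf hm hi hi'
  have hr := h.reindex (Equiv.addLeft i) (.inl fun a => by simp [add_assoc])
  obtain ⟨e, he, he0, he1⟩ : ∃ e : ZMod m ≃ ZMod m,
      ((∀ a, e (a + 1) = e a + 1) ∨ ∀ a, e (a + 1) = e a - 1) ∧ e 0 = j ∧ e 1 = k := by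
    rcases hjk with rfl | rfl
    · exact ⟨Equiv.addLeft j, .inl fun a => by simp [add_assoc], by simp, by simp⟩
    · exact ⟨Equiv.subLeft (k + 1), .inr fun a => by simp; ring, by simp, by simp⟩
  have hr' := h'.reindex e he
  refine hr.exists_digraphIso hr' fun a => hr.eq_iff_eq_of_mem_block_iff hr' hf
    (hr.mem_block_iff hr' hf ?_ ?_ a)
  · simpa [he0] using hj
  · simpa [he1] using hk

/-- Block cycles with the same number of blocks and isomorphic underlying multigraphs are
isomorphic. -/
lemma exists_digraphIso_of_multigraphIso (h : IsBlockCycle m p q G)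
    (h' : IsBlockCycle m p' q' G') (hf : MultigraphIso G G' f) [NeZero m]
    (hcard : (Finset.univ.filter fun i => p i = q i).card =
      (Finset.univ.filter fun i => p' i = q' i).card) : ∃ g : ℕ → ℕ, DigraphIso G G' g := by
  by_cases hm : m = 3
  · subst hm
    obtain ⟨r, hr⟩ := exists_rotation_of_card_eq_three _ _ hcard
    exact h.exists_digraphIso
      (h'.reindex (Equiv.addRight r) (.inl fun a => by simp only [Equiv.coe_addRight]; ring))
      fun i => by simpa using hr i
  · have hm : 4 ≤ m := by have := h.three_le; omega
    by_cases hmix : ∃ i, p i = q i ∧ p (i + 1) ≠ q (i + 1)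
    · obtain ⟨i, hi, hi'⟩ := hmix
      exact h.exists_digraphIso_of_mixed h' hf hm hi hi'
    · push Not at hmix
      by_cases hex : ∃ i, p i = q i
      · obtain ⟨i, hi⟩ := hex
        have hn : ∀ n : ℕ, p (i + n) = q (i + n) := fun n => by
          induction n with
          | zero => simpa using hi
          | succ n ih => simpa [add_assoc] using hmix _ ih
        have hall : ∀ j, p j = q j := fun j => by simpa using hn (j - i).val
        have hall' : ∀ j, p' j = q' j := by
          rw [Finset.filter_true_of_mem fun j _ => hall j] at hcard
          have := Finset.eq_univ_of_card _ (hcard.symm.trans Finset.card_univ)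
          simpa [Finset.filter_eq_self] using this
        exact h.exists_digraphIso h' fun j => by simp [hall, hall']
      · push Not at hex
        have hex' : ∀ j, p' j ≠ q' j := by
          rw [Finset.filter_false_of_mem fun j _ => hex j, Finset.card_empty] at hcard
          simpa [Finset.filter_eq_empty_iff] using hcard.symm
        exact h.exists_digraphIso h' fun j => by simp [hex, hex']

end IsBlockCycle

theorem stmt8 (G G' : FinDigraph ℕ)
    (hG : (∃ m, IsWDC m G) ∧ G.Nonlinear) (hG' : (∃ m, IsWDC m G') ∧ G'.Nonlinear)
    (h : ∃ f : ℕ → ℕ, MultigraphIso G G' f) : ∃ g : ℕ → ℕ, DigraphIso G G' g := by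
  obtain ⟨⟨⟨m, hw⟩, hn⟩, ⟨⟨m', hw'⟩, hn'⟩⟩ := And.intro hG hG'
  obtain ⟨f, hf⟩ := h
  obtain ⟨p, q, hb⟩ := hw.exists_isBlockCycle hn
  obtain ⟨p', q', hb'⟩ := hw'.exists_isBlockCycle hn'
  have : NeZero m := ⟨by have := hb.three_le; omega⟩
  have : NeZero m' := ⟨by have := hb'.three_le; omega⟩
  have hV : G.V.card = G'.V.card :=
    Finset.card_nbij f (fun _ hx => hf.1.mapsTo hx) hf.1.injOn hf.1.surjOn
  have hD : (G.V.filter fun x => multDegree G x = 4).card =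
      (G'.V.filter fun x => multDegree G' x = 4).card := by
    refine Finset.card_nbij f (fun x hx => ?_)
      (hf.1.injOn.mono fun x hx => (Finset.mem_filter.1 hx).1) fun y hy => ?_
    · have hx := Finset.mem_filter.1 hx
      exact Finset.mem_filter.2 ⟨hf.1.mapsTo hx.1, (hf.multDegree_eq hx.1).trans hx.2⟩
    · have hy := Finset.mem_filter.1 hy
      obtain ⟨x, hx, rfl⟩ := hf.1.surjOn hy.1
      exact ⟨x, Finset.mem_filter.2 ⟨hx, (hf.multDegree_eq hx).symm.trans hy.2⟩, rfl⟩
  rw [hb.card_filter_multDegree, hb'.card_filter_multDegree] at hD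
  have hmm : m = m' := by
    have := hb.card_V_add
    have := hb'.card_V_add
    omega
  subst hmm
  exact hb.exists_digraphIso_of_multigraphIso hb' hf hD
end
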